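/- Let G = (A ∪ B, E) be a marriage instance with critical men C ⊆ A that admits a feasible matching, and let e ∈ E. Then e belongs to some popular feasible matching of G if and only if e belongs to some minimum size popular feasible matching of G or to some dominant feasible matching of G. -/

import Mathlib

open Classical

universe u v

/-- A marriage instance with critical men: a finite bipartite graph with edge set `E ⊆ A × B`,
a set `C ⊆ A` of critical men, and strict preference orders of each vertex over its
neighbours (`prefA m w w'` : man `m` strictly prefers woman `w` to woman `w'`;
`prefB w m m'` : woman `w` strictly prefers man `m` to man `m'`). -/
structure CritInstance (A : Type u) (B : Type v) where
  E : Finset (A × B)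
  C : Finset A
  prefA : A → B → B → Prop
  prefB : B → A → A → Prop
  prefA_irrefl : ∀ m w, ¬ prefA m w w
  prefA_trans : ∀ m w₁ w₂ w₃, prefA m w₁ w₂ → prefA m w₂ w₃ → prefA m w₁ w₃
  prefA_total : ∀ m w₁ w₂, (m, w₁) ∈ E → (m, w₂) ∈ E → w₁ ≠ w₂ →
    prefA m w₁ w₂ ∨ prefA m w₂ w₁
  prefB_irrefl : ∀ w m, ¬ prefB w m m
  prefB_trans : ∀ w m₁ m₂ m₃, prefB w m₁ m₂ → prefB w m₂ m₃ → prefB w m₁ m₃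
  prefB_total : ∀ w m₁ m₂, (m₁, w) ∈ E → (m₂, w) ∈ E → m₁ ≠ m₂ →
    prefB w m₁ m₂ ∨ prefB w m₂ m₁

namespace CritInstance

variable {A : Type u} {B : Type v}

/-- `M` is a matching: a set of edges in which every vertex has at most one partner. -/
def IsMatching (I : CritInstance A B) (M : Finset (A × B)) : Prop :=
  M ⊆ I.E ∧ (∀ ⦃m w w'⦄, (m, w) ∈ M → (m, w') ∈ M → w = w') ∧
    (∀ ⦃m m' w⦄, (m, w) ∈ M → (m', w) ∈ M → m = m')

/-- Man `m` is matched in `M`. -/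
def ManMatched (M : Finset (A × B)) (m : A) : Prop := ∃ w, (m, w) ∈ M

/-- Woman `w` is matched in `M`. -/
def WomanMatched (M : Finset (A × B)) (w : B) : Prop := ∃ m, (m, w) ∈ M

/-- `M` is feasible: it is a matching and every critical man is matched. -/
def IsFeasible (I : CritInstance A B) (M : Finset (A × B)) : Prop :=
  IsMatching I M ∧ ∀ m ∈ I.C, ManMatched M m

/-- Man `m` prefers matching `M` to matching `N`: he is matched in `M` and either
unmatched in `N` or strictly prefers his `M`-partner to his `N`-partner. -/
def ManPrefers (I : CritInstance A B) (M N : Finset (A × B)) (m : A) : Prop :=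
  ∃ w, (m, w) ∈ M ∧ (¬ ManMatched N m ∨ ∃ w', (m, w') ∈ N ∧ I.prefA m w w')

/-- Woman `w` prefers matching `M` to matching `N`. -/
def WomanPrefers (I : CritInstance A B) (M N : Finset (A × B)) (w : B) : Prop :=
  ∃ m, (m, w) ∈ M ∧ (¬ WomanMatched N w ∨ ∃ m', (m', w) ∈ N ∧ I.prefB w m m')

/-- `phi I M N` is the number of vertices that prefer `M` to `N`. -/
noncomputable def phi [Fintype A] [Fintype B] (I : CritInstance A B)
    (M N : Finset (A × B)) : ℕ :=
  (Finset.univ.filter fun m : A => ManPrefers I M N m).card +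
    (Finset.univ.filter fun w : B => WomanPrefers I M N w).card

/-- `M` is a popular feasible matching. -/
def IsPFM [Fintype A] [Fintype B] (I : CritInstance A B) (M : Finset (A × B)) : Prop :=
  IsFeasible I M ∧ ∀ N, IsFeasible I N → phi I N M ≤ phi I M N

/-- `M` is a minimum size popular feasible matching. -/
def IsMinPFM [Fintype A] [Fintype B] (I : CritInstance A B) (M : Finset (A × B)) : Prop :=
  IsPFM I M ∧ ∀ N, IsPFM I N → M.card ≤ N.card

/-- `M` is a dominant feasible matching. -/
def IsDFM [Fintype A] [Fintype B] (I : CritInstance A B) (M : Finset (A × B)) : Prop :=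
  IsPFM I M ∧ ∀ N, IsFeasible I N → M.card < N.card → phi I N M < phi I M N

/-- `(m,w)` is a `(+1,+1)` edge with respect to `M`: an edge of `E ∖ M` such that `m` is
unmatched or prefers `w` to his partner, and `w` is unmatched or prefers `m` to her partner. -/
def PlusPlus (I : CritInstance A B) (M : Finset (A × B)) (m : A) (w : B) : Prop :=
  (m, w) ∈ I.E ∧ (m, w) ∉ M ∧
    (¬ ManMatched M m ∨ ∃ w', (m, w') ∈ M ∧ I.prefA m w w') ∧
    (¬ WomanMatched M w ∨ ∃ m', (m', w) ∈ M ∧ I.prefB w m m')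

/-- `(m,w)` is a `(−1,−1)` edge with respect to `M`: an edge of `E ∖ M` such that `m` is
matched and prefers his partner to `w`, and `w` is matched and prefers her partner to `m`. -/
def MinusMinus (I : CritInstance A B) (M : Finset (A × B)) (m : A) (w : B) : Prop :=
  (m, w) ∈ I.E ∧ (m, w) ∉ M ∧
    (∃ w', (m, w') ∈ M ∧ I.prefA m w' w) ∧
    (∃ m', (m', w) ∈ M ∧ I.prefB w m' m)

/-- `M` is a stable matching: a matching with no blocking pair. -/
def IsStable (I : CritInstance A B) (M : Finset (A × B)) : Prop :=
  IsMatching I M ∧ ∀ m w, ¬ PlusPlus I M m w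

/-- The min-size conditions for a level assignment `(lA, lB)` with respect to `M`:
(i) matched partners share a level, unmatched vertices have level 0, non-critical men
have level 0; (ii) every `(+1,+1)` edge goes from a man to a strictly higher level woman;
(iii) every edge from a man at level `i` to a woman at level `i − 1` is a `(−1,−1)` edge;
(iv) no edge goes from a man at level `i` to a woman at level `≤ i − 2`. -/
def MinSizeConds (I : CritInstance A B) (M : Finset (A × B))
    (lA : A → ℕ) (lB : B → ℕ) : Prop :=
  (∀ m w, (m, w) ∈ M → lA m = lB w) ∧
  (∀ m, ¬ ManMatched M m → lA m = 0) ∧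
  (∀ w, ¬ WomanMatched M w → lB w = 0) ∧
  (∀ m, m ∉ I.C → lA m = 0) ∧
  (∀ m w, PlusPlus I M m w → lA m < lB w) ∧
  (∀ m w, (m, w) ∈ I.E → lB w + 1 = lA m → MinusMinus I M m w) ∧
  (∀ m w, (m, w) ∈ I.E → ¬ (lB w + 2 ≤ lA m))

/-- The dominant conditions for a level assignment `(lA, lB)` with respect to `M`:
(i) matched partners share a level, unmatched women have level 0, unmatched men have
level 1, non-critical men have level at most 1; (ii)–(iv) as in the min-size conditions. -/
def DomConds (I : CritInstance A B) (M : Finset (A × B))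
    (lA : A → ℕ) (lB : B → ℕ) : Prop :=
  (∀ m w, (m, w) ∈ M → lA m = lB w) ∧
  (∀ m, ¬ ManMatched M m → lA m = 1) ∧
  (∀ w, ¬ WomanMatched M w → lB w = 0) ∧
  (∀ m, m ∉ I.C → lA m ≤ 1) ∧
  (∀ m w, PlusPlus I M m w → lA m < lB w) ∧
  (∀ m w, (m, w) ∈ I.E → lB w + 1 = lA m → MinusMinus I M m w) ∧
  (∀ m w, (m, w) ∈ I.E → ¬ (lB w + 2 ≤ lA m))

/-- Adjacency in the bipartite graph, on the vertex set `A ⊕ B`. -/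
def Adj (I : CritInstance A B) : A ⊕ B → A ⊕ B → Prop
  | Sum.inl m, Sum.inr w => (m, w) ∈ I.E
  | Sum.inr w, Sum.inl m => (m, w) ∈ I.E
  | _, _ => False

/-- The (directed) pair `(u, v)` of vertices spans an edge of the matching `M`. -/
def StepM (M : Finset (A × B)) : A ⊕ B → A ⊕ B → Prop
  | Sum.inl m, Sum.inr w => (m, w) ∈ M
  | Sum.inr w, Sum.inl m => (m, w) ∈ M
  | _, _ => False

/-- The pair `(u, v)` of vertices spans a `(+1,+1)` edge with respect to `M`. -/
def StepPP (I : CritInstance A B) (M : Finset (A × B)) : A ⊕ B → A ⊕ B → Prop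
  | Sum.inl m, Sum.inr w => PlusPlus I M m w
  | Sum.inr w, Sum.inl m => PlusPlus I M m w
  | _, _ => False

/-- The pair `(u, v)` of vertices spans a `(−1,−1)` edge with respect to `M`. -/
def StepMM (I : CritInstance A B) (M : Finset (A × B)) : A ⊕ B → A ⊕ B → Prop
  | Sum.inl m, Sum.inr w => MinusMinus I M m w
  | Sum.inr w, Sum.inl m => MinusMinus I M m w
  | _, _ => False

/-- A vertex of `A ⊕ B` is matched in `M`. -/
def VMatched (M : Finset (A × B)) : A ⊕ B → Prop
  | Sum.inl m => ManMatched M m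
  | Sum.inr w => WomanMatched M w

/-- An `M`-alternating path in the graph: a sequence of distinct vertices
`vert 0, …, vert len` (`len ≥ 1` edges), consecutive vertices adjacent, with
consecutive edges alternately inside and outside `M`. -/
structure AltPath (I : CritInstance A B) (M : Finset (A × B)) where
  len : ℕ
  len_pos : 0 < len
  vert : ℕ → A ⊕ B
  inj : ∀ i j, i ≤ len → j ≤ len → vert i = vert j → i = j
  adj : ∀ i, i < len → Adj I (vert i) (vert (i + 1))
  alternate : ∀ i, i + 1 < len →
    (StepM M (vert i) (vert (i + 1)) ↔ ¬ StepM M (vert (i + 1)) (vert (i + 2)))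

namespace AltPath

variable {I : CritInstance A B} {M : Finset (A × B)}

/-- The number of `(+1,+1)` edges of the path. -/
noncomputable def countPP (ρ : AltPath I M) : ℕ :=
  ((Finset.range ρ.len).filter fun i => StepPP I M (ρ.vert i) (ρ.vert (i + 1))).card

/-- The number of `(−1,−1)` edges of the path. -/
noncomputable def countMM (ρ : AltPath I M) : ℕ :=
  ((Finset.range ρ.len).filter fun i => StepMM I M (ρ.vert i) (ρ.vert (i + 1))).card

/-- The vertex `u` lies on the path. -/
def Mem (ρ : AltPath I M) (u : A ⊕ B) : Prop := ∃ i ≤ ρ.len, ρ.vert i = u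

/-- The set of edges of the path, as a set of pairs in `A × B`. -/
noncomputable def edges (ρ : AltPath I M) : Finset (A × B) :=
  I.E.filter fun e => ∃ i < ρ.len,
    (ρ.vert i = Sum.inl e.1 ∧ ρ.vert (i + 1) = Sum.inr e.2) ∨
    (ρ.vert i = Sum.inr e.2 ∧ ρ.vert (i + 1) = Sum.inl e.1)

end AltPath

/-- An `M`-alternating cycle: a closed sequence of vertices `vert 0, …, vert len = vert 0`
(distinct except for the return), consecutive vertices adjacent, with edges alternately
inside and outside `M`, including around the wrap. -/
structure AltCycle (I : CritInstance A B) (M : Finset (A × B)) where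
  len : ℕ
  len_pos : 0 < len
  vert : ℕ → A ⊕ B
  closed : vert len = vert 0
  inj : ∀ i j, i < len → j < len → vert i = vert j → i = j
  adj : ∀ i, i < len → Adj I (vert i) (vert (i + 1))
  alternate : ∀ i, i + 1 < len →
    (StepM M (vert i) (vert (i + 1)) ↔ ¬ StepM M (vert (i + 1)) (vert (i + 2)))
  alternate_wrap : StepM M (vert (len - 1)) (vert len) ↔ ¬ StepM M (vert 0) (vert 1)

namespace AltCycle

variable {I : CritInstance A B} {M : Finset (A × B)}

/-- The number of `(+1,+1)` edges of the cycle. -/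
noncomputable def countPP (σ : AltCycle I M) : ℕ :=
  ((Finset.range σ.len).filter fun i => StepPP I M (σ.vert i) (σ.vert (i + 1))).card

/-- The number of `(−1,−1)` edges of the cycle. -/
noncomputable def countMM (σ : AltCycle I M) : ℕ :=
  ((Finset.range σ.len).filter fun i => StepMM I M (σ.vert i) (σ.vert (i + 1))).card

end AltCycle

/-- A size-increasing alternating path (SIAP) for `M`: an `M`-alternating path whose two
endpoints are a man unmatched in `M` and a woman unmatched in `M`, and which has equally
many `(+1,+1)` and `(−1,−1)` edges. -/
def IsSIAP (I : CritInstance A B) (M : Finset (A × B)) (ρ : AltPath I M) : Prop :=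
  (((∃ m, ρ.vert 0 = Sum.inl m ∧ ¬ ManMatched M m) ∧
      (∃ w, ρ.vert ρ.len = Sum.inr w ∧ ¬ WomanMatched M w)) ∨
    ((∃ w, ρ.vert 0 = Sum.inr w ∧ ¬ WomanMatched M w) ∧
      (∃ m, ρ.vert ρ.len = Sum.inl m ∧ ¬ ManMatched M m))) ∧
  ρ.countPP = ρ.countMM

/-- A size-reducing alternating path (SRAP) for `M` with respect to the level assignment
`(lA, lB)`: an `M`-alternating path both of whose terminal edges lie in `M`, starting at a
woman matched in `M` at level 0, ending at a non-critical man at level 1, whose number of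
`(+1,+1)` edges is exactly one more than its number of `(−1,−1)` edges. -/
def IsSRAP (I : CritInstance A B) (M : Finset (A × B)) (lA : A → ℕ) (lB : B → ℕ)
    (ρ : AltPath I M) : Prop :=
  StepM M (ρ.vert 0) (ρ.vert 1) ∧
  StepM M (ρ.vert (ρ.len - 1)) (ρ.vert ρ.len) ∧
  (((∃ w, ρ.vert 0 = Sum.inr w ∧ WomanMatched M w ∧ lB w = 0) ∧
      (∃ m, ρ.vert ρ.len = Sum.inl m ∧ m ∉ I.C ∧ lA m = 1)) ∨
    ((∃ m, ρ.vert 0 = Sum.inl m ∧ m ∉ I.C ∧ lA m = 1) ∧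
      (∃ w, ρ.vert ρ.len = Sum.inr w ∧ WomanMatched M w ∧ lB w = 0))) ∧
  ρ.countPP = ρ.countMM + 1

end CritInstance

/-- The sum of the weights of the consecutive pairs of a list. -/
def walkWeight {V : Type*} (c : V → V → ℤ) : List V → ℤ
  | a :: b :: l => c a b + walkWeight c (b :: l)
  | _ => 0

theorem walkWeight_append {V : Type*} (c : V → V → ℤ) (u : V) (l₂ : List V) :
    ∀ l₁ : List V, walkWeight c (l₁ ++ u :: l₂) =
      walkWeight c (l₁ ++ [u]) + walkWeight c (u :: l₂)
  | [] => by simp [walkWeight]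
  | [a] => by simp [walkWeight]
  | a :: b :: l => by
    have ih := walkWeight_append c u l₂ (b :: l)
    simp only [List.cons_append, walkWeight] at ih ⊢
    rw [ih, add_assoc]

theorem walkWeight_eq_sum_map {V : Type*} (c : V → V → ℤ) (s : V → V) (u : V) :
    ∀ l : List V, List.IsChain (fun a b => s a = b) (l ++ [u]) →
      ((l ++ [u]).map fun a => c a (s a)).sum = walkWeight c (l ++ [u]) + c u (s u)
  | [], _ => by simp [walkWeight]
  | [a], h => by
    have : s a = u := by simpa using h
    simp [walkWeight, this]
  | a :: b :: l, h => by
    have ih := walkWeight_eq_sum_map c s u (b :: l)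
      (by simp only [List.cons_append, List.isChain_cons_cons] at h ⊢; exact h.2)
    have hab : s a = b := by
      simp only [List.cons_append, List.isChain_cons_cons] at h; exact h.1
    simp only [List.cons_append, walkWeight, List.map_cons, List.sum_cons] at ih ⊢
    rw [ih, hab]; ring

/-- If the weight of every closed simple walk is nonpositive, then so is the weight of a simple walk
`l ++ [u]` from `v` to `u` together with that of the pair `(u, v)`. -/
theorem closed_walkWeight_nonpos {V : Type*} [Fintype V] (R : V → V → Prop) (c : V → V → ℤ)
    (hR : ∀ u, R u u) (hc : ∀ u, c u u = 0)
    (h : ∀ σ : Equiv.Perm V, (∀ u, R u (σ u)) → ∑ u, c u (σ u) ≤ 0)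
    (l : List V) (u v : V) (hnd : (l ++ [u]).Nodup) (hch : (l ++ [u]).IsChain R)
    (hv : (l ++ [u]).head? = some v) (huv : R u v) :
    walkWeight c (l ++ [u]) + c u v ≤ 0 := by
  set L := l ++ [u] with hL
  have hlen : L.length = l.length + 1 := by simp [hL]
  have hnext : ∀ (i : ℕ) (hi : i + 1 < L.length), L.formPerm L[i] = L[i + 1] := fun i hi =>
    List.formPerm_apply_lt_getElem _ hnd i hi
  have hv0 : L[0]'(by omega) = v := by
    rw [List.head?_eq_getElem?, List.getElem?_eq_getElem (by omega)] at hv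
    exact Option.some.inj hv
  have hlast : L[l.length]'(by omega) = u := by simp [hL]
  have hwrap : L.formPerm u = v := by
    have := List.formPerm_apply_getElem L hnd l.length (by omega)
    rw [hlast] at this
    rw [this, ← hv0]
    simp [hlen]
  have hchain : L.IsChain (fun a b => L.formPerm a = b) := by
    rw [List.isChain_iff_getElem]
    exact fun i hi => hnext i hi
  have hsum : ∑ a, c a (L.formPerm a) = (L.map fun a => c a (L.formPerm a)).sum := by
    rw [← List.sum_toFinset _ hnd]
    symm
    apply Finset.sum_subset (Finset.subset_univ _)
    intro a _ ha
    rw [List.formPerm_apply_of_notMem (by simpa using ha), hc]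
  have hle := h L.formPerm (by
    intro a
    by_cases ha : a ∈ L
    · obtain ⟨i, hi, rfl⟩ := List.getElem_of_mem ha
      by_cases hi' : i + 1 < L.length
      · rw [hnext i hi']
        exact List.isChain_iff_getElem.1 hch i hi'
      · have : i = l.length := by omega
        subst this
        rw [hlast, hwrap]
        exact huv
    · rw [List.formPerm_apply_of_notMem ha]
      exact hR a)
  rw [hsum, walkWeight_eq_sum_map c _ u l hchain, ← hL, hwrap] at hle
  exact hle

/-- A system of difference constraints without positive cycles is solvable. -/
theorem exists_potential {V : Type*} [Fintype V] (R : V → V → Prop) (c : V → V → ℤ)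
    (hR : ∀ u, R u u) (hc : ∀ u, c u u = 0)
    (h : ∀ σ : Equiv.Perm V, (∀ u, R u (σ u)) → ∑ u, c u (σ u) ≤ 0) :
    ∃ x : V → ℤ, ∀ u v, R u v → c u v + x v ≤ x u := by
  have key : ∀ u, ∃ l : List V, ((u :: l).Nodup ∧ (u :: l).IsChain R) ∧
      ∀ l' : List V, (u :: l').Nodup ∧ (u :: l').IsChain R →
        walkWeight c (u :: l') ≤ walkWeight c (u :: l) := by
    intro u
    have hfin : {l : List V | (u :: l).Nodup ∧ (u :: l).IsChain R}.Finite := by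
      refine (List.finite_length_le V (Fintype.card V)).subset ?_
      rintro l ⟨hl, -⟩
      exact (List.nodup_cons.1 hl).2.length_le_card
    obtain ⟨l, hl, hmax⟩ := hfin.exists_maximalFor (fun l => walkWeight c (u :: l)) _
      ⟨[], by simp⟩
    exact ⟨l, hl, fun l' hl' => (le_total _ _).elim id (hmax hl')⟩
  choose p hp hmax using key
  refine ⟨fun u => walkWeight c (u :: p u), fun u v huv => ?_⟩
  obtain ⟨hnd, hch⟩ := hp v
  by_cases hu : u ∈ v :: p v
  · obtain ⟨l₁, l₂, hl⟩ := List.append_of_mem hu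
    rw [hl] at hnd hch
    have hsplit : l₁ ++ u :: l₂ = (l₁ ++ [u]) ++ l₂ := by simp
    have h₁ := closed_walkWeight_nonpos R c hR hc h l₁ u v
      (by rw [hsplit] at hnd; exact (List.nodup_append.1 hnd).1)
      (by rw [hsplit] at hch; exact hch.left_of_append)
      (by
        have : (l₁ ++ u :: l₂).head? = some v := by rw [← hl]; rfl
        cases l₁ <;> simpa using this) huv
    have h₂ := hmax u l₂ ⟨(List.nodup_append.1 hnd).2.1, hch.right_of_append⟩
    have h₃ := walkWeight_append c u l₂ l₁
    rw [← hl] at h₃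
    dsimp only
    linarith
  · exact hmax u (v :: p v) ⟨List.nodup_cons.2 ⟨hu, hnd⟩, List.isChain_cons_cons.2 ⟨huv, hch⟩⟩

/-- Two strict partial orders on a finite type have a common stable antichain. -/
theorem exists_stable_antichain {α : Type*} [Finite α] (P Q : α → α → Prop)
    [IsTrans α P] [Std.Irrefl P] [IsTrans α Q] [Std.Irrefl Q] :
    ∃ T : Set α, (∀ a ∈ T, ∀ b ∈ T, ¬ P a b) ∧ (∀ a ∈ T, ∀ b ∈ T, ¬ Q a b) ∧
      ∀ a ∉ T, (∃ b ∈ T, P b a) ∨ ∃ b ∈ T, Q b a := by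
  have best : ∀ (P : α → α → Prop) [IsTrans α P] [Std.Irrefl P] (X : Set α) (a : α),
      (∃ b ∈ X, P b a) → ∃ b ∈ X, P b a ∧ ∀ b' ∈ X, ¬ P b' b := by
    intro P _ _ X a hX
    obtain ⟨b, ⟨hb, hba⟩, hmin⟩ :=
      (Finite.wellFounded_of_trans_of_irrefl P).has_min {b | b ∈ X ∧ P b a}
        (by obtain ⟨b, hb⟩ := hX; exact ⟨b, hb⟩)
    exact ⟨b, hb, hba, fun b' hb' h => hmin b' ⟨hb', _root_.trans h hba⟩ h⟩
  let keep : (α → α → Prop) → Set α → Set α := fun P X => {a | ¬ ∃ b ∈ X, P b a}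
  have anti : ∀ P, Antitone (keep P) := fun P X Y hXY a ha ⟨b, hb, hba⟩ => ha ⟨b, hXY hb, hba⟩
  let F : Set α →o Set α := ⟨fun X => keep Q (keep P X), fun X Y h => anti Q (anti P h)⟩
  set X := OrderHom.lfp F
  set Y := keep P X with hY
  have hX : keep Q Y = X := F.map_lfp
  have memX : ∀ a, a ∈ X ↔ ¬ ∃ b ∈ Y, Q b a := fun a => by rw [← hX]; rfl
  have memY : ∀ a, a ∈ Y ↔ ¬ ∃ b ∈ X, P b a := fun a => by rw [hY]; rfl
  refine ⟨X ∩ Y, fun a ha b hb hab => (memY b).1 hb.2 ⟨a, ha.1, hab⟩,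
    fun a ha b hb hab => (memX b).1 hb.1 ⟨a, ha.2, hab⟩, fun a ha => ?_⟩
  by_cases haX : a ∈ X
  · have haY : a ∉ Y := fun h => ha ⟨haX, h⟩
    rw [memY, not_not] at haY
    obtain ⟨b, hb, hba, hbest⟩ := best P X a haY
    exact Or.inl ⟨b, ⟨hb, (memY b).2 fun ⟨b', hb', h⟩ => hbest b' hb' h⟩, hba⟩
  · rw [memX, not_not] at haX
    obtain ⟨b, hb, hba, hbest⟩ := best Q Y a haX
    exact Or.inr ⟨b, ⟨(memX b).2 fun ⟨b', hb', h⟩ => hbest b' hb' h, hb⟩, hba⟩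

namespace CritInstance

variable {A : Type u} {B : Type v} {I : CritInstance A B} {M N : Finset (A × B)}

/-- The vote of man `m` between woman `w` and his situation in `M`. -/
noncomputable def voteA (I : CritInstance A B) (M : Finset (A × B)) (m : A) (w : B) : ℤ :=
  if (m, w) ∈ M then 0 else if ∃ w', (m, w') ∈ M ∧ ¬ I.prefA m w w' then -1 else 1

/-- The vote of woman `w` between man `m` and her situation in `M`. -/
noncomputable def voteB (I : CritInstance A B) (M : Finset (A × B)) (m : A) (w : B) : ℤ :=
  if (m, w) ∈ M then 0 else if ∃ m', (m', w) ∈ M ∧ ¬ I.prefB w m m' then -1 else 1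

theorem voteA_of_mem {m : A} {w : B} (h : (m, w) ∈ M) : voteA I M m w = 0 := if_pos h

theorem voteB_of_mem {m : A} {w : B} (h : (m, w) ∈ M) : voteB I M m w = 0 := if_pos h

theorem voteA_of_notMem {m : A} {w : B} (h : (m, w) ∉ M) :
    voteA I M m w = -1 ∨ voteA I M m w = 1 := by
  unfold voteA; split_ifs <;> simp

theorem voteB_of_notMem {m : A} {w : B} (h : (m, w) ∉ M) :
    voteB I M m w = -1 ∨ voteB I M m w = 1 := by
  unfold voteB; split_ifs <;> simp

theorem voteA_of_not_matched {m : A} (h : ¬ ManMatched M m) (w : B) : voteA I M m w = 1 := by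
  unfold voteA
  rw [if_neg fun h' => h ⟨w, h'⟩, if_neg fun ⟨w', h', _⟩ => h ⟨w', h'⟩]

theorem voteB_of_not_matched {w : B} (h : ¬ WomanMatched M w) (m : A) : voteB I M m w = 1 := by
  unfold voteB
  rw [if_neg fun h' => h ⟨m, h'⟩, if_neg fun ⟨m', h', _⟩ => h ⟨m', h'⟩]

theorem voteA_eq_one_iff (hM : IsMatching I M) {m : A} {w w₀ : B} (h₀ : (m, w₀) ∈ M) :
    voteA I M m w = 1 ↔ I.prefA m w w₀ := by
  unfold voteA
  split_ifs with h₁ h₂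
  · obtain rfl := hM.2.1 h₁ h₀
    simp [I.prefA_irrefl]
  · obtain ⟨w', hw', hn⟩ := h₂
    obtain rfl := hM.2.1 hw' h₀
    simp [hn]
  · push Not at h₂
    simp [h₂ _ h₀]

theorem voteB_eq_one_iff (hM : IsMatching I M) {m m₀ : A} {w : B} (h₀ : (m₀, w) ∈ M) :
    voteB I M m w = 1 ↔ I.prefB w m m₀ := by
  unfold voteB
  split_ifs with h₁ h₂
  · obtain rfl := hM.2.2 h₁ h₀
    simp [I.prefB_irrefl]
  · obtain ⟨m', hm', hn⟩ := h₂
    obtain rfl := hM.2.2 hm' h₀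
    simp [hn]
  · push Not at h₂
    simp [h₂ _ h₀]

theorem vote_add_even (m : A) (w : B) : (voteA I M m w + voteB I M m w) % 2 = 0 := by
  by_cases h : (m, w) ∈ M
  · simp [voteA_of_mem h, voteB_of_mem h]
  · rcases voteA_of_notMem (I := I) h with h₁ | h₁ <;>
      rcases voteB_of_notMem (I := I) h with h₂ | h₂ <;> simp [h₁, h₂]

theorem voteA_bounds (m : A) (w : B) : -1 ≤ voteA I M m w ∧ voteA I M m w ≤ 1 := by
  unfold voteA; split_ifs <;> simp

theorem voteB_bounds (m : A) (w : B) : -1 ≤ voteB I M m w ∧ voteB I M m w ≤ 1 := by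
  unfold voteB; split_ifs <;> simp

/-- The signed vote of man `m` between `N` and `M`. -/
noncomputable def balanceA (I : CritInstance A B) (N M : Finset (A × B)) (m : A) : ℤ :=
  (if ManPrefers I N M m then 1 else 0) - (if ManPrefers I M N m then 1 else 0)

/-- The signed vote of woman `w` between `N` and `M`. -/
noncomputable def balanceB (I : CritInstance A B) (N M : Finset (A × B)) (w : B) : ℤ :=
  (if WomanPrefers I N M w then 1 else 0) - (if WomanPrefers I M N w then 1 else 0)

theorem phi_sub_phi [Fintype A] [Fintype B] (I : CritInstance A B) (N M : Finset (A × B)) :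
    (phi I N M : ℤ) - phi I M N = ∑ m, balanceA I N M m + ∑ w, balanceB I N M w := by
  simp only [phi, balanceA, balanceB, Finset.sum_sub_distrib, Finset.sum_boole]
  push_cast
  ring

theorem balanceA_of_mem (hN : IsMatching I N) (hM : IsMatching I M) {m : A} {w : B}
    (h : (m, w) ∈ N) : balanceA I N M m = voteA I M m w := by
  have hNm : ManMatched N m := ⟨w, h⟩
  by_cases hm : ManMatched M m
  · obtain ⟨w₀, h₀⟩ := hm
    have e₁ : ManPrefers I N M m ↔ I.prefA m w w₀ := by
      constructor
      · rintro ⟨w₁, h₁, h₂ | ⟨w₂, h₂, h₃⟩⟩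
        · exact absurd ⟨w₀, h₀⟩ h₂
        · rwa [hN.2.1 h h₁, hM.2.1 h₀ h₂]
      · exact fun hp => ⟨w, h, Or.inr ⟨w₀, h₀, hp⟩⟩
    have e₂ : ManPrefers I M N m ↔ I.prefA m w₀ w := by
      constructor
      · rintro ⟨w₁, h₁, h₂ | ⟨w₂, h₂, h₃⟩⟩
        · exact absurd hNm h₂
        · rwa [hN.2.1 h h₂, hM.2.1 h₀ h₁]
      · exact fun hp => ⟨w₀, h₀, Or.inr ⟨w, h, hp⟩⟩
    have hv := voteA_eq_one_iff hM h₀ (w := w)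
    unfold balanceA
    rw [e₁, e₂]
    by_cases hw : w = w₀
    · subst hw
      simp [I.prefA_irrefl, voteA_of_mem h₀]
    · have hn : (m, w) ∉ M := fun h' => hw (hM.2.1 h' h₀)
      by_cases hp : I.prefA m w w₀
      · have hp' : ¬ I.prefA m w₀ w := fun h' =>
          I.prefA_irrefl _ _ (I.prefA_trans _ _ _ _ hp h')
        simp [hp, hp', hv.2 hp]
      · have hp' := (I.prefA_total m w w₀ (hN.1 h) (hM.1 h₀) hw).resolve_left hp
        rcases voteA_of_notMem (I := I) hn with h₁ | h₁
        · simp [hp, hp', h₁]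
        · exact absurd (hv.1 h₁) hp
  · have e₁ : ManPrefers I N M m := ⟨w, h, Or.inl hm⟩
    have e₂ : ¬ ManPrefers I M N m := fun ⟨w', h', _⟩ => hm ⟨w', h'⟩
    simp [balanceA, e₁, e₂, voteA_of_not_matched hm]

theorem balanceB_of_mem (hN : IsMatching I N) (hM : IsMatching I M) {m : A} {w : B}
    (h : (m, w) ∈ N) : balanceB I N M w = voteB I M m w := by
  have hNw : WomanMatched N w := ⟨m, h⟩
  by_cases hm : WomanMatched M w
  · obtain ⟨m₀, h₀⟩ := hm
    have e₁ : WomanPrefers I N M w ↔ I.prefB w m m₀ := by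
      constructor
      · rintro ⟨m₁, h₁, h₂ | ⟨m₂, h₂, h₃⟩⟩
        · exact absurd ⟨m₀, h₀⟩ h₂
        · rwa [hN.2.2 h h₁, hM.2.2 h₀ h₂]
      · exact fun hp => ⟨m, h, Or.inr ⟨m₀, h₀, hp⟩⟩
    have e₂ : WomanPrefers I M N w ↔ I.prefB w m₀ m := by
      constructor
      · rintro ⟨m₁, h₁, h₂ | ⟨m₂, h₂, h₃⟩⟩
        · exact absurd hNw h₂
        · rwa [hN.2.2 h h₂, hM.2.2 h₀ h₁]
      · exact fun hp => ⟨m₀, h₀, Or.inr ⟨m, h, hp⟩⟩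
    have hv := voteB_eq_one_iff hM h₀ (m := m)
    unfold balanceB
    rw [e₁, e₂]
    by_cases hw : m = m₀
    · subst hw
      simp [I.prefB_irrefl, voteB_of_mem h₀]
    · have hn : (m, w) ∉ M := fun h' => hw (hM.2.2 h' h₀)
      by_cases hp : I.prefB w m m₀
      · have hp' : ¬ I.prefB w m₀ m := fun h' =>
          I.prefB_irrefl _ _ (I.prefB_trans _ _ _ _ hp h')
        simp [hp, hp', hv.2 hp]
      · have hp' := (I.prefB_total w m m₀ (hN.1 h) (hM.1 h₀) hw).resolve_left hp
        rcases voteB_of_notMem (I := I) hn with h₁ | h₁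
        · simp [hp, hp', h₁]
        · exact absurd (hv.1 h₁) hp
  · have e₁ : WomanPrefers I N M w := ⟨m, h, Or.inl hm⟩
    have e₂ : ¬ WomanPrefers I M N w := fun ⟨w', h', _⟩ => hm ⟨w', h'⟩
    simp [balanceB, e₁, e₂, voteB_of_not_matched hm]

theorem balanceA_of_not_matched {m : A} (h : ¬ ManMatched N m) :
    balanceA I N M m = if ManMatched M m then -1 else 0 := by
  have e₁ : ¬ ManPrefers I N M m := fun ⟨w', h', _⟩ => h ⟨w', h'⟩
  have e₂ : ManPrefers I M N m ↔ ManMatched M m :=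
    ⟨fun ⟨w', h', _⟩ => ⟨w', h'⟩, fun ⟨w', h'⟩ => ⟨w', h', Or.inl h⟩⟩
  unfold balanceA
  rw [if_neg e₁, e₂]
  split_ifs <;> rfl

theorem balanceB_of_not_matched {w : B} (h : ¬ WomanMatched N w) :
    balanceB I N M w = if WomanMatched M w then -1 else 0 := by
  have e₁ : ¬ WomanPrefers I N M w := fun ⟨w', h', _⟩ => h ⟨w', h'⟩
  have e₂ : WomanPrefers I M N w ↔ WomanMatched M w :=
    ⟨fun ⟨w', h', _⟩ => ⟨w', h'⟩, fun ⟨w', h'⟩ => ⟨w', h', Or.inl h⟩⟩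
  unfold balanceB
  rw [if_neg e₁, e₂]
  split_ifs <;> rfl

theorem sum_men_eq [Fintype A] (hN : IsMatching I N) (f : A → ℤ) :
    ∑ m, f m = ∑ e ∈ N, f e.1 + ∑ m with ¬ ManMatched N m, f m := by
  rw [← Finset.sum_filter_add_sum_filter_not _ (ManMatched N)]
  congr 1
  have : Finset.univ.filter (ManMatched N) = N.image Prod.fst := by
    ext m; simp [ManMatched]
  rw [this, Finset.sum_image]
  rintro ⟨m, w⟩ h ⟨m', w'⟩ h' (rfl : m = m')
  rw [hN.2.1 h h']

theorem sum_women_eq [Fintype B] (hN : IsMatching I N) (f : B → ℤ) :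
    ∑ w, f w = ∑ e ∈ N, f e.2 + ∑ w with ¬ WomanMatched N w, f w := by
  rw [← Finset.sum_filter_add_sum_filter_not _ (WomanMatched N)]
  congr 1
  have : Finset.univ.filter (WomanMatched N) = N.image Prod.snd := by
    ext m; simp [WomanMatched]
  rw [this, Finset.sum_image]
  rintro ⟨m, w⟩ h ⟨m', w'⟩ h' (rfl : w = w')
  rw [hN.2.2 h h']

/-- `(yA, yB)` is an optimal dual solution certifying that `M` is a popular feasible matching. -/
structure IsWitness (I : CritInstance A B) (M : Finset (A × B)) (yA : A → ℤ) (yB : B → ℤ) :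
    Prop where
  edge : ∀ m w, (m, w) ∈ I.E → voteA I M m w + voteB I M m w ≤ yA m + yB w
  tight : ∀ m w, (m, w) ∈ M → yA m + yB w = 0
  man_unmatched : ∀ m, ¬ ManMatched M m → yA m = 0
  woman_unmatched : ∀ w, ¬ WomanMatched M w → yB w = 0
  man : ∀ m, m ∉ I.C → -1 ≤ yA m
  woman : ∀ w, -1 ≤ yB w

theorem IsWitness.phi_add_slack_le [Fintype A] [Fintype B] {yA : A → ℤ} {yB : B → ℤ}
    (hy : IsWitness I M yA yB) (hM : IsMatching I M) (hN : IsFeasible I N) (δ : A → ℤ)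
    (h₁ : ∀ m w, (m, w) ∈ N → voteA I M m w + voteB I M m w + δ m ≤ yA m + yB w)
    (h₂ : ∀ m, ¬ ManMatched N m → ManMatched M m → -1 + δ m ≤ yA m)
    (h₃ : ∀ m, ¬ ManMatched N m → ¬ ManMatched M m → δ m ≤ 0) :
    (phi I N M : ℤ) + ∑ m, δ m ≤ phi I M N := by
  have hdual : ∑ m, yA m + ∑ w, yB w = 0 := by
    rw [sum_men_eq hM, sum_women_eq hM,
      Finset.sum_eq_zero (s := Finset.univ.filter fun m => ¬ ManMatched M m)
        (fun m hm => hy.man_unmatched m (Finset.mem_filter.1 hm).2),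
      Finset.sum_eq_zero (s := Finset.univ.filter fun w => ¬ WomanMatched M w)
        (fun w hw => hy.woman_unmatched w (Finset.mem_filter.1 hw).2),
      add_zero, add_zero, ← Finset.sum_add_distrib]
    exact Finset.sum_eq_zero fun e he => hy.tight e.1 e.2 he
  have hbal := phi_sub_phi I N M
  have hslack : ∑ m, (balanceA I N M m + δ m) + ∑ w, balanceB I N M w ≤
      ∑ m, yA m + ∑ w, yB w := by
    rw [sum_men_eq hN.1, sum_women_eq hN.1, sum_men_eq hN.1 yA, sum_women_eq hN.1 yB]
    have i₁ : ∑ e ∈ N, (balanceA I N M e.1 + δ e.1) + ∑ e ∈ N, balanceB I N M e.2 ≤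
        ∑ e ∈ N, yA e.1 + ∑ e ∈ N, yB e.2 := by
      rw [← Finset.sum_add_distrib, ← Finset.sum_add_distrib]
      refine Finset.sum_le_sum fun e he => ?_
      rw [balanceA_of_mem hN.1 hM he, balanceB_of_mem hN.1 hM he]
      linarith [h₁ e.1 e.2 he]
    have i₂ : ∑ m with ¬ ManMatched N m, (balanceA I N M m + δ m) ≤
        ∑ m with ¬ ManMatched N m, yA m := by
      refine Finset.sum_le_sum fun m hm => ?_
      replace hm := (Finset.mem_filter.1 hm).2
      rw [balanceA_of_not_matched hm]
      split_ifs with hMm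
      · exact h₂ m hm hMm
      · rw [hy.man_unmatched m hMm, zero_add]
        exact h₃ m hm hMm
    have i₃ : ∑ w with ¬ WomanMatched N w, balanceB I N M w ≤
        ∑ w with ¬ WomanMatched N w, yB w := by
      refine Finset.sum_le_sum fun w hw => ?_
      replace hw := (Finset.mem_filter.1 hw).2
      rw [balanceB_of_not_matched hw]
      split_ifs with hMw
      · exact hy.woman w
      · rw [hy.woman_unmatched w hMw]
    linarith
  rw [Finset.sum_add_distrib] at hslack
  linarith

theorem IsWitness.isPFM [Fintype A] [Fintype B] {yA : A → ℤ} {yB : B → ℤ}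
    (hy : IsWitness I M yA yB) (hM : IsFeasible I M) : IsPFM I M := by
  refine ⟨hM, fun N hN => ?_⟩
  have := hy.phi_add_slack_le hM.1 hN (fun _ => 0)
    (fun m w h => by simpa using hy.edge m w (hN.1.1 h))
    (fun m hm _ => by simpa using hy.man m fun hc => hm (hN.2 m hc)) (by simp)
  simpa using this

theorem exists_man_of_card_lt (hM : IsMatching I M) (h : N.card < M.card) :
    ∃ m, ManMatched M m ∧ ¬ ManMatched N m := by
  by_contra! hc
  have h₁ : (M.image Prod.fst).card = M.card := by
    apply Finset.card_image_of_injOn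
    rintro ⟨m, w⟩ h ⟨m', w'⟩ h' (rfl : m = m')
    rw [hM.2.1 h h']
  have h₂ : M.image Prod.fst ⊆ N.image Prod.fst := by
    intro m hm
    obtain ⟨⟨m, w⟩, hw, rfl⟩ := Finset.mem_image.1 hm
    obtain ⟨w', hw'⟩ := hc m ⟨w, hw⟩
    exact Finset.mem_image.2 ⟨_, hw', rfl⟩
  have := Finset.card_le_card h₂
  have := Finset.card_image_le (s := N) (f := Prod.fst)
  omega

theorem IsWitness.isMinPFM [Fintype A] [Fintype B] {yA : A → ℤ} {yB : B → ℤ}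
    (hy : IsWitness I M yA yB) (hM : IsFeasible I M)
    (heven : ∀ m w, (m, w) ∈ M → yA m % 2 = 0) : IsMinPFM I M := by
  refine ⟨hy.isPFM hM, fun N hN => ?_⟩
  by_contra! hlt
  obtain ⟨m₀, hm₀, hm₀'⟩ := exists_man_of_card_lt hM.1 hlt
  have := hy.phi_add_slack_le hM.1 hN.1 (fun m => if m = m₀ then 1 else 0)
    (fun m w h => by
      have := hy.edge m w (hN.1.1.1 h)
      have hne : m ≠ m₀ := by rintro rfl; exact hm₀' ⟨w, h⟩
      simpa [hne] using this)
    (fun m hm hmM => by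
      have h₁ := hy.man m fun hc => hm (hN.1.2 m hc)
      obtain ⟨w, hw⟩ := hmM
      have := heven m w hw
      split_ifs <;> omega)
    (fun m hm hmM => by
      have : m ≠ m₀ := by rintro rfl; exact hmM hm₀
      simp [this])
  have hle := hN.2 M hM
  simp only [Finset.sum_ite_eq', Finset.mem_univ, if_true] at this
  omega

theorem IsWitness.isDFM [Fintype A] [Fintype B] {yA : A → ℤ} {yB : B → ℤ}
    (hy : IsWitness I M yA yB) (hM : IsFeasible I M)
    (hodd : ∀ m w, (m, w) ∈ M → yA m % 2 = 1) : IsDFM I M := by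
  refine ⟨hy.isPFM hM, fun N hN hlt => ?_⟩
  obtain ⟨m₀, hm₀, hm₀'⟩ := exists_man_of_card_lt hN.1 hlt
  have := hy.phi_add_slack_le hM.1 hN (fun m => if m = m₀ then 1 else 0)
    (fun m w h => by
      have h₁ := hy.edge m w (hN.1.1 h)
      split_ifs with hm
      · subst hm
        have h₂ := hy.man_unmatched m hm₀'
        have h₃ := voteA_of_not_matched (I := I) hm₀' w
        have h₄ := vote_add_even (I := I) (M := M) m w
        by_cases hw : WomanMatched M w
        · obtain ⟨m', hm'⟩ := hw
          have := hodd m' w hm'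
          have := hy.tight m' w hm'
          omega
        · have := hy.woman_unmatched w hw
          have := voteB_of_not_matched (I := I) hw m
          omega
      · simpa using h₁)
    (fun m hm hmM => by
      have hne : m ≠ m₀ := by rintro rfl; exact hm hm₀
      simpa [hne] using hy.man m fun hc => hm (hN.2 m hc))
    (fun m hm _ => by
      have hne : m ≠ m₀ := by rintro rfl; exact hm hm₀
      simp [hne])
  simp only [Finset.sum_ite_eq', Finset.mem_univ, if_true] at this
  omega

/-- The perfect matching of the graph extended by a private dummy for every vertex that `M` induces:
matched vertices are joined as in `M`, as are their dummies, and an unmatched vertex is joined to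
its dummy. On the left are the men and the dummies of women. -/
noncomputable def extend (M : Finset (A × B)) : A ⊕ B → B ⊕ A
  | Sum.inl m => if h : ManMatched M m then Sum.inl h.choose else Sum.inr m
  | Sum.inr w => if h : WomanMatched M w then Sum.inr h.choose else Sum.inl w

/-- The inverse of `extend M`. -/
noncomputable def extendInv (M : Finset (A × B)) : B ⊕ A → A ⊕ B
  | Sum.inl w => if h : WomanMatched M w then Sum.inl h.choose else Sum.inr w
  | Sum.inr m => if h : ManMatched M m then Sum.inr h.choose else Sum.inl m

theorem choose_man (hM : IsMatching I M) {m : A} {w : B} (h : (m, w) ∈ M)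
    (hm : ManMatched M m) : hm.choose = w := hM.2.1 hm.choose_spec h

theorem choose_woman (hM : IsMatching I M) {m : A} {w : B} (h : (m, w) ∈ M)
    (hw : WomanMatched M w) : hw.choose = m := hM.2.2 hw.choose_spec h

theorem extend_man (hM : IsMatching I M) {m : A} {w : B} (h : (m, w) ∈ M) :
    extend M (Sum.inl m) = Sum.inl w := by
  have hm : ManMatched M m := ⟨w, h⟩
  simp [extend, hm, choose_man hM h]

theorem extend_dummy (hM : IsMatching I M) {m : A} {w : B} (h : (m, w) ∈ M) :
    extend M (Sum.inr w) = Sum.inr m := by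
  have hw : WomanMatched M w := ⟨m, h⟩
  simp [extend, hw, choose_woman hM h]

theorem extendInv_woman (hM : IsMatching I M) {m : A} {w : B} (h : (m, w) ∈ M) :
    extendInv M (Sum.inl w) = Sum.inl m := by
  have hw : WomanMatched M w := ⟨m, h⟩
  simp [extendInv, hw, choose_woman hM h]

theorem extendInv_dummy (hM : IsMatching I M) {m : A} {w : B} (h : (m, w) ∈ M) :
    extendInv M (Sum.inr m) = Sum.inr w := by
  have hm : ManMatched M m := ⟨w, h⟩
  simp [extendInv, hm, choose_man hM h]

theorem extend_of_man_not_matched {m : A} (h : ¬ ManMatched M m) :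
    extend M (Sum.inl m) = Sum.inr m := by simp [extend, h]

theorem extend_of_woman_not_matched {w : B} (h : ¬ WomanMatched M w) :
    extend M (Sum.inr w) = Sum.inl w := by simp [extend, h]

theorem extendInv_of_man_not_matched {m : A} (h : ¬ ManMatched M m) :
    extendInv M (Sum.inr m) = Sum.inl m := by simp [extendInv, h]

theorem extendInv_of_woman_not_matched {w : B} (h : ¬ WomanMatched M w) :
    extendInv M (Sum.inl w) = Sum.inr w := by simp [extendInv, h]

/-- `extend M` as an equivalence. -/
noncomputable def extendEquiv (hM : IsMatching I M) : A ⊕ B ≃ B ⊕ A where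
  toFun := extend M
  invFun := extendInv M
  left_inv := by
    rintro (m | w)
    · by_cases h : ManMatched M m
      · obtain ⟨w, hw⟩ := h
        rw [extend_man hM hw, extendInv_woman hM hw]
      · rw [extend_of_man_not_matched h, extendInv_of_man_not_matched h]
    · by_cases h : WomanMatched M w
      · obtain ⟨m, hm⟩ := h
        rw [extend_dummy hM hm, extendInv_dummy hM hm]
      · rw [extend_of_woman_not_matched h, extendInv_of_woman_not_matched h]
  right_inv := by
    rintro (w | m)
    · by_cases h : WomanMatched M w
      · obtain ⟨m, hm⟩ := h
        rw [extendInv_woman hM hm, extend_man hM hm]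
      · rw [extendInv_of_woman_not_matched h, extend_of_woman_not_matched h]
    · by_cases h : ManMatched M m
      · obtain ⟨w, hw⟩ := h
        rw [extendInv_dummy hM hw, extend_dummy hM hw]
      · rw [extendInv_of_man_not_matched h, extend_of_man_not_matched h]

/-- The edges of the extended graph. -/
def ExtAdj (I : CritInstance A B) : A ⊕ B → B ⊕ A → Prop
  | Sum.inl m, Sum.inl w => (m, w) ∈ I.E
  | Sum.inl m, Sum.inr m' => m = m' ∧ m ∉ I.C
  | Sum.inr w, Sum.inl w' => w = w'
  | Sum.inr _, Sum.inr _ => True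

/-- The vote of the man on an edge of the extended graph. -/
noncomputable def extVoteA (I : CritInstance A B) (M : Finset (A × B)) : A ⊕ B → B ⊕ A → ℤ
  | Sum.inl m, Sum.inl w => voteA I M m w
  | Sum.inl m, Sum.inr _ => if ManMatched M m then -1 else 0
  | Sum.inr _, _ => 0

/-- The vote of the woman on an edge of the extended graph. -/
noncomputable def extVoteB (I : CritInstance A B) (M : Finset (A × B)) : A ⊕ B → B ⊕ A → ℤ
  | Sum.inl m, Sum.inl w => voteB I M m w
  | Sum.inr _, Sum.inl w => if WomanMatched M w then -1 else 0
  | _, Sum.inr _ => 0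

theorem extAdj_extend (hM : IsFeasible I M) (u : A ⊕ B) : ExtAdj I u (extend M u) := by
  rcases u with m | w
  · by_cases h : ManMatched M m
    · obtain ⟨w, hw⟩ := h
      rw [extend_man hM.1 hw]
      exact hM.1.1 hw
    · rw [extend_of_man_not_matched h]
      exact ⟨rfl, fun hc => h (hM.2 m hc)⟩
  · by_cases h : WomanMatched M w
    · obtain ⟨m, hm⟩ := h
      rw [extend_dummy hM.1 hm]
      trivial
    · rw [extend_of_woman_not_matched h]
      rfl

theorem extVote_extend (hM : IsMatching I M) (u : A ⊕ B) :
    extVoteA I M u (extend M u) + extVoteB I M u (extend M u) = 0 := by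
  rcases u with m | w
  · by_cases h : ManMatched M m
    · obtain ⟨w, hw⟩ := h
      rw [extend_man hM hw]
      simp [extVoteA, extVoteB, voteA_of_mem hw, voteB_of_mem hw]
    · rw [extend_of_man_not_matched h]
      simp [extVoteA, extVoteB, h]
  · by_cases h : WomanMatched M w
    · obtain ⟨m, hm⟩ := h
      rw [extend_dummy hM hm]
      simp [extVoteA, extVoteB]
    · rw [extend_of_woman_not_matched h]
      simp [extVoteA, extVoteB, h]

/-- The matching induced by a perfect matching of the extended graph. -/
noncomputable def restrict (I : CritInstance A B) (ν : A ⊕ B ≃ B ⊕ A) : Finset (A × B) :=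
  I.E.filter fun e => ν (Sum.inl e.1) = Sum.inl e.2

theorem mem_restrict {ν : A ⊕ B ≃ B ⊕ A} (hν : ∀ u, ExtAdj I u (ν u)) {m : A} {w : B} :
    (m, w) ∈ restrict I ν ↔ ν (Sum.inl m) = Sum.inl w := by
  simp only [restrict, Finset.mem_filter, and_iff_right_iff_imp]
  intro h
  have := hν (Sum.inl m)
  rwa [h] at this

theorem restrict_isFeasible {ν : A ⊕ B ≃ B ⊕ A} (hν : ∀ u, ExtAdj I u (ν u)) :
    IsFeasible I (restrict I ν) := by
  refine ⟨⟨Finset.filter_subset _ _, fun m w w' h h' => ?_, fun m m' w h h' => ?_⟩,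
    fun m hm => ?_⟩
  · rw [mem_restrict hν] at h h'
    exact Sum.inl_injective (h.symm.trans h')
  · rw [mem_restrict hν] at h h'
    exact Sum.inl_injective (ν.injective (h.trans h'.symm))
  · have := hν (Sum.inl m)
    rcases h : ν (Sum.inl m) with w | m'
    · exact ⟨w, (mem_restrict hν).2 h⟩
    · rw [h] at this
      exact absurd hm this.2

theorem sum_extVote [Fintype A] [Fintype B] (hM : IsMatching I M) {ν : A ⊕ B ≃ B ⊕ A}
    (hν : ∀ u, ExtAdj I u (ν u)) :
    ∑ u, (extVoteA I M u (ν u) + extVoteB I M u (ν u)) =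
      phi I (restrict I ν) M - phi I M (restrict I ν) := by
  have hN := (restrict_isFeasible hν).1
  rw [phi_sub_phi, Finset.sum_add_distrib]
  congr 1
  · rw [Fintype.sum_sum_type]
    have : ∀ w : B, extVoteA I M (Sum.inr w) (ν (Sum.inr w)) = 0 := fun w => rfl
    simp only [this, Finset.sum_const_zero, add_zero]
    refine Finset.sum_congr rfl fun m _ => ?_
    rcases h : ν (Sum.inl m) with w | m'
    · rw [balanceA_of_mem hN hM ((mem_restrict hν).2 h)]
      rfl
    · rw [balanceA_of_not_matched]
      · rfl
      · rintro ⟨w, hw⟩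
        rw [mem_restrict hν, h] at hw
        simp at hw
  · have hreindex : ∑ u, extVoteB I M u (ν u) = ∑ r, extVoteB I M (ν.symm r) r := by
      rw [← Equiv.sum_comp ν]
      simp
    rw [hreindex, Fintype.sum_sum_type]
    have : ∀ m : A, extVoteB I M (ν.symm (Sum.inr m)) (Sum.inr m) = 0 := fun m => by
      cases ν.symm (Sum.inr m) <;> rfl
    simp only [this, Finset.sum_const_zero, add_zero]
    refine Finset.sum_congr rfl fun w _ => ?_
    rcases h : ν.symm (Sum.inl w) with m | w'
    · rw [balanceB_of_mem hN hM ((mem_restrict hν).2 (ν.symm_apply_eq.1 h).symm)]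
      rfl
    · rw [balanceB_of_not_matched]
      · rfl
      · rintro ⟨m, hm⟩
        rw [mem_restrict hν, ← ν.eq_symm_apply, h] at hm
        simp at hm

theorem IsPFM.exists_isWitness [Fintype A] [Fintype B] (hM : IsPFM I M) :
    ∃ yA yB, IsWitness I M yA yB := by
  rcases isEmpty_or_nonempty A with hA | hA
  · have hmem : ∀ m w, (m, w) ∉ I.E := fun m => hA.elim m
    exact ⟨fun _ => 0, fun _ => 0, fun m => hA.elim m, fun m => hA.elim m, fun _ _ => rfl,
      fun _ _ => rfl, by simp, by simp⟩
  obtain ⟨x, hx⟩ := exists_potential (fun u v => ExtAdj I u (extend M v))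
    (fun u v => extVoteA I M u (extend M v) + extVoteB I M u (extend M v))
    (fun u => extAdj_extend hM.1 u) (fun u => extVote_extend hM.1.1 u) (by
      intro σ hσ
      have hν : ∀ u, ExtAdj I u ((σ.trans (extendEquiv hM.1.1)) u) := hσ
      have h₁ := sum_extVote hM.1.1 hν
      have h₂ := hM.2 _ (restrict_isFeasible hν)
      have h₃ : ∑ u, (extVoteA I M u (extend M (σ u)) + extVoteB I M u (extend M (σ u))) ≤ 0 := by
        refine h₁.le.trans ?_
        omega
      exact h₃)
  have hright : ∀ r, extend M (extendInv M r) = r := (extendEquiv hM.1.1).right_inv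
  let z : B ⊕ A → ℤ := fun r => - x (extendInv M r)
  have hz : ∀ u r, ExtAdj I u r → extVoteA I M u r + extVoteB I M u r ≤ x u + z r := by
    intro u r hur
    have := hx u (extendInv M r) (by rwa [hright])
    rw [hright] at this
    simp only [z]
    linarith
  have hzM : ∀ u, x u + z (extend M u) = 0 := by
    intro u
    have : extendInv M (extend M u) = u := (extendEquiv hM.1.1).left_inv u
    simp [z, this]
  obtain ⟨a, ha⟩ := Finite.exists_min fun m : A => z (Sum.inr m)
  set t := z (Sum.inr a) with ht
  have hdummy : ∀ w : B, -t ≤ x (Sum.inr w) := fun w => by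
    have : 0 + 0 ≤ x (Sum.inr w) + z (Sum.inr a) := hz (Sum.inr w) (Sum.inr a) trivial
    linarith
  have hmatched : ∀ m w, (m, w) ∈ M → z (Sum.inr m) = t ∧ x (Sum.inr w) = -t := by
    intro m w h
    have := hzM (Sum.inr w)
    rw [extend_dummy hM.1.1 h] at this
    have := ha m
    have := hdummy w
    constructor <;> linarith
  refine ⟨fun m => if ManMatched M m then x (Sum.inl m) + t else 0,
    fun w => if WomanMatched M w then z (Sum.inl w) - t else 0, ⟨?_, ?_, ?_, ?_, ?_, ?_⟩⟩
  · intro m w h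
    have h₁ : voteA I M m w + voteB I M m w ≤ x (Sum.inl m) + z (Sum.inl w) :=
      hz (Sum.inl m) (Sum.inl w) h
    have h₂ : ¬ ManMatched M m → x (Sum.inl m) + t ≤ 0 := fun hm => by
      have := hzM (Sum.inl m)
      rw [extend_of_man_not_matched hm] at this
      linarith [ha m]
    have h₃ : ¬ WomanMatched M w → z (Sum.inl w) - t ≤ 0 := fun hw => by
      have := hzM (Sum.inr w)
      rw [extend_of_woman_not_matched hw] at this
      linarith [hdummy w]
    split_ifs with hm hw hw
    · linarith
    · linarith [h₃ hw]
    · linarith [h₂ hm]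
    · linarith [h₂ hm, h₃ hw]
  · intro m w h
    have hm : ManMatched M m := ⟨w, h⟩
    have hw : WomanMatched M w := ⟨m, h⟩
    have := hzM (Sum.inl m)
    rw [extend_man hM.1.1 h] at this
    simp only [hm, hw, if_true]
    linarith
  · intro m hm
    simp [hm]
  · intro w hw
    simp [hw]
  · intro m hm
    split_ifs with hmM
    · obtain ⟨w, hw⟩ := hmM
      have h₁ : extVoteA I M (Sum.inl m) (Sum.inr m) + 0 ≤ x (Sum.inl m) + z (Sum.inr m) :=
        hz (Sum.inl m) (Sum.inr m) ⟨rfl, hm⟩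
      have h₂ : extVoteA I M (Sum.inl m) (Sum.inr m) = -1 := if_pos ⟨w, hw⟩
      linarith [(hmatched m w hw).1]
    · norm_num
  · intro w
    split_ifs with hwM
    · obtain ⟨m, hm⟩ := hwM
      have h₁ : 0 + extVoteB I M (Sum.inr w) (Sum.inl w) ≤ x (Sum.inr w) + z (Sum.inl w) :=
        hz (Sum.inr w) (Sum.inl w) rfl
      have h₂ : extVoteB I M (Sum.inr w) (Sum.inl w) = -1 := if_pos ⟨m, hm⟩
      linarith [(hmatched m w hm).2]
    · norm_num

/-- Man `a.1` prefers the labelled edge `a` to `b`: he prefers high labels to low ones. -/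
def ManBetter (I : CritInstance A B) (a b : A × B × ℤ) : Prop :=
  a.1 = b.1 ∧ (b.2.2 < a.2.2 ∨ a.2.2 = b.2.2 ∧ I.prefA a.1 a.2.1 b.2.1)

/-- Woman `a.2.1` prefers the labelled edge `a` to `b`: she prefers low labels to high ones. -/
def WomanBetter (I : CritInstance A B) (a b : A × B × ℤ) : Prop :=
  a.2.1 = b.2.1 ∧ (a.2.2 < b.2.2 ∨ a.2.2 = b.2.2 ∧ I.prefB a.2.1 a.1 b.1)

instance : IsTrans (A × B × ℤ) (ManBetter I) where
  trans := by
    rintro ⟨m, w₁, k₁⟩ ⟨m₂, w₂, k₂⟩ ⟨m₃, w₃, k₃⟩ ⟨e₁, h₁⟩ ⟨e₂, h₂⟩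
    obtain rfl : m = m₂ := e₁
    obtain rfl : m = m₃ := e₂
    refine ⟨rfl, ?_⟩
    dsimp only at h₁ h₂ ⊢
    rcases h₁ with h₁ | ⟨h₁, p₁⟩ <;> rcases h₂ with h₂ | ⟨h₂, p₂⟩
    · exact Or.inl (by omega)
    · exact Or.inl (by omega)
    · exact Or.inl (by omega)
    · exact Or.inr ⟨by omega, I.prefA_trans _ _ _ _ p₁ p₂⟩

instance : Std.Irrefl (ManBetter I) where
  irrefl := by
    rintro a ⟨-, h | h⟩
    · exact lt_irrefl _ h
    · exact I.prefA_irrefl _ _ h.2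

instance : IsTrans (A × B × ℤ) (WomanBetter I) where
  trans := by
    rintro ⟨m₁, w, k₁⟩ ⟨m₂, w₂, k₂⟩ ⟨m₃, w₃, k₃⟩ ⟨e₁, h₁⟩ ⟨e₂, h₂⟩
    obtain rfl : w = w₂ := e₁
    obtain rfl : w = w₃ := e₂
    refine ⟨rfl, ?_⟩
    dsimp only at h₁ h₂ ⊢
    rcases h₁ with h₁ | ⟨h₁, p₁⟩ <;> rcases h₂ with h₂ | ⟨h₂, p₂⟩
    · exact Or.inl (by omega)
    · exact Or.inl (by omega)
    · exact Or.inl (by omega)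
    · exact Or.inr ⟨by omega, I.prefB_trans _ _ _ _ p₁ p₂⟩

instance : Std.Irrefl (WomanBetter I) where
  irrefl := by
    rintro a ⟨-, h | h⟩
    · exact lt_irrefl _ h
    · exact I.prefB_irrefl _ _ h.2

/-- `T` is a stable matching in the bipartite multigraph with set `X` of labelled edges. -/
structure IsLabelledStable (I : CritInstance A B) (X T : Set (A × B × ℤ)) : Prop where
  subset : T ⊆ X
  man_unique : ∀ {m w w' k k'}, (m, w, k) ∈ T → (m, w', k') ∈ T → w = w' ∧ k = k'
  woman_unique : ∀ {m m' w k k'}, (m, w, k) ∈ T → (m', w, k') ∈ T → m = m' ∧ k = k'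
  stable : ∀ a ∈ X, a ∉ T → (∃ b ∈ T, ManBetter I b a) ∨ ∃ b ∈ T, WomanBetter I b a

theorem exists_isLabelledStable (X : Set (A × B × ℤ)) (hfin : X.Finite)
    (hE : ∀ m w k, (m, w, k) ∈ X → (m, w) ∈ I.E) : ∃ T, IsLabelledStable I X T := by
  have := hfin.to_subtype
  let P : X → X → Prop := fun a b => ManBetter I a b
  let Q : X → X → Prop := fun a b => WomanBetter I a b
  have : IsTrans X P := ⟨fun a b c h h' => IsTrans.trans (r := ManBetter I) a.1 b.1 c.1 h h'⟩
  have : IsTrans X Q := ⟨fun a b c h h' => IsTrans.trans (r := WomanBetter I) a.1 b.1 c.1 h h'⟩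
  have : Std.Irrefl P := ⟨fun a => Std.Irrefl.irrefl (r := ManBetter I) a.1⟩
  have : Std.Irrefl Q := ⟨fun a => Std.Irrefl.irrefl (r := WomanBetter I) a.1⟩
  obtain ⟨T, hP, hQ, hst⟩ := exists_stable_antichain P Q
  refine ⟨Subtype.val '' T, ?_, ?_, ?_, ?_⟩
  · rintro _ ⟨a, -, rfl⟩
    exact a.2
  · rintro m w w' k k' ⟨a, ha, ea⟩ ⟨b, hb, eb⟩
    have h₁ := hP a ha b hb
    have h₂ := hP b hb a ha
    have hEa := hE m w k (ea ▸ a.2)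
    have hEb := hE m w' k' (eb ▸ b.2)
    simp only [P, ManBetter, ea, eb, true_and] at h₁ h₂
    push Not at h₁ h₂
    have hk : k = k' := le_antisymm h₁.1 h₂.1
    refine ⟨?_, hk⟩
    by_contra hw
    rcases I.prefA_total m w w' hEa hEb hw with h | h
    · exact h₁.2 hk h
    · exact h₂.2 hk.symm h
  · rintro m m' w k k' ⟨a, ha, ea⟩ ⟨b, hb, eb⟩
    have h₁ := hQ a ha b hb
    have h₂ := hQ b hb a ha
    have hEa := hE m w k (ea ▸ a.2)
    have hEb := hE m' w k' (eb ▸ b.2)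
    simp only [Q, WomanBetter, ea, eb, true_and] at h₁ h₂
    push Not at h₁ h₂
    have hk : k = k' := le_antisymm h₂.1 h₁.1
    refine ⟨?_, hk⟩
    by_contra hm
    rcases I.prefB_total w m m' hEa hEb hm with h | h
    · exact h₁.2 hk h
    · exact h₂.2 hk.symm h
  · intro a ha haT
    rcases hst ⟨a, ha⟩ (fun h => haT ⟨_, h, rfl⟩) with ⟨b, hb, h⟩ | ⟨b, hb, h⟩
    · exact Or.inl ⟨b, ⟨b, hb, rfl⟩, h⟩
    · exact Or.inr ⟨b, ⟨b, hb, rfl⟩, h⟩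

/-- The edges, labelled by integers of parity `r`, that may be used to rematch the vertices whose
dual value does not have parity `r`. The label of an edge becomes the dual value of its man. -/
def rematchEdges (I : CritInstance A B) (M : Finset (A × B)) (yA : A → ℤ) (yB : B → ℤ) (r : ℤ) :
    Set (A × B × ℤ) :=
  {a | ((a.1, a.2.1) ∈ I.E ∧ yA a.1 % 2 ≠ r ∧ yB a.2.1 % 2 ≠ r) ∧
    (a.2.2 % 2 = r ∧ a.2.2 ≤ 1 ∧ (a.1 ∉ I.C → -1 ≤ a.2.2)) ∧
    (yA a.1 - 1 ≤ a.2.2 ∧ (a.2.2 = yA a.1 - 1 → 0 ≤ voteA I M a.1 a.2.1)) ∧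
    (a.2.2 ≤ 1 - yB a.2.1 ∧ (a.2.2 = 1 - yB a.2.1 → 0 ≤ voteB I M a.1 a.2.1))}

theorem mem_rematchEdges {yA : A → ℤ} {yB : B → ℤ} {r : ℤ} {m : A} {w : B} {k : ℤ} :
    (m, w, k) ∈ rematchEdges I M yA yB r ↔
      ((m, w) ∈ I.E ∧ yA m % 2 ≠ r ∧ yB w % 2 ≠ r) ∧ (k % 2 = r ∧ k ≤ 1 ∧ (m ∉ I.C → -1 ≤ k)) ∧
      (yA m - 1 ≤ k ∧ (k = yA m - 1 → 0 ≤ voteA I M m w)) ∧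
      (k ≤ 1 - yB w ∧ (k = 1 - yB w → 0 ≤ voteB I M m w)) := Iff.rfl

theorem finite_rematchEdges (yA : A → ℤ) (yB : B → ℤ) (r : ℤ) :
    (rematchEdges I M yA yB r).Finite := by
  refine (I.E.finite_toSet.biUnion fun e _ => (Set.finite_Icc (yA e.1 - 1) 1).image
    fun k => (e.1, e.2, k)).subset ?_
  rintro ⟨m, w, k⟩ h
  obtain ⟨⟨hE, -⟩, ⟨-, hk, -⟩, ⟨hk', -⟩, -⟩ := mem_rematchEdges.1 h
  exact Set.mem_biUnion (x := (m, w)) hE ⟨k, ⟨hk', hk⟩, rfl⟩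

/-- A vertex does not lose by moving to a better partner. -/
theorem voteA_nonneg_of_pref (hM : IsMatching I M) {m : A} {w w₀ : B}
    (h₀ : 0 ≤ voteA I M m w₀) (hp : I.prefA m w w₀) : 0 ≤ voteA I M m w := by
  by_cases hm : ManMatched M m
  · obtain ⟨w₁, h₁⟩ := hm
    have hv := voteA_eq_one_iff hM h₁ (w := w)
    have hv₀ := voteA_eq_one_iff hM h₁ (w := w₀)
    by_cases h : (m, w₀) ∈ M
    · obtain rfl := hM.2.1 h h₁
      rw [hv.2 hp]
      norm_num
    · have : voteA I M m w₀ = 1 := by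
        rcases voteA_of_notMem (I := I) h with h | h <;> omega
      rw [hv.2 (I.prefA_trans _ _ _ _ hp (hv₀.1 this))]
      norm_num
  · rw [voteA_of_not_matched hm]
    norm_num

theorem voteB_nonneg_of_pref (hM : IsMatching I M) {m m₀ : A} {w : B}
    (h₀ : 0 ≤ voteB I M m₀ w) (hp : I.prefB w m m₀) : 0 ≤ voteB I M m w := by
  by_cases hw : WomanMatched M w
  · obtain ⟨m₁, h₁⟩ := hw
    have hv := voteB_eq_one_iff hM h₁ (m := m)
    have hv₀ := voteB_eq_one_iff hM h₁ (m := m₀)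
    by_cases h : (m₀, w) ∈ M
    · obtain rfl := hM.2.2 h h₁
      rw [hv.2 hp]
      norm_num
    · have : voteB I M m₀ w = 1 := by
        rcases voteB_of_notMem (I := I) h with h | h <;> omega
      rw [hv.2 (I.prefB_trans _ _ _ _ hp (hv₀.1 this))]
      norm_num
  · rw [voteB_of_not_matched hw]
    norm_num

theorem voteA_le_voteA {S : Finset (A × B)} (hM : IsMatching I M) (hS : IsMatching I S)
    {m : A} {w w₀ : B} (hn : (m, w) ∉ M) (hw₀ : (m, w₀) ∈ S)
    (h₀ : 0 ≤ voteA I M m w₀) : voteA I S m w ≤ voteA I M m w := by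
  rcases voteA_of_notMem (I := I) hn with h | h
  · by_cases hw : I.prefA m w w₀
    · have := voteA_nonneg_of_pref hM h₀ hw
      omega
    · have h₁ : voteA I S m w ≠ 1 := fun h' => hw ((voteA_eq_one_iff hS hw₀).1 h')
      have h₂ : (m, w) ∉ S := fun h' => by
        obtain rfl := hS.2.1 h' hw₀
        omega
      rcases voteA_of_notMem (I := I) h₂ with h | h <;> omega
  · rw [h]
    exact (voteA_bounds m w).2

theorem voteB_le_voteB {S : Finset (A × B)} (hM : IsMatching I M) (hS : IsMatching I S)
    {m m₀ : A} {w : B} (hn : (m, w) ∉ M) (hm₀ : (m₀, w) ∈ S)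
    (h₀ : 0 ≤ voteB I M m₀ w) : voteB I S m w ≤ voteB I M m w := by
  rcases voteB_of_notMem (I := I) hn with h | h
  · by_cases hw : I.prefB w m m₀
    · have := voteB_nonneg_of_pref hM h₀ hw
      omega
    · have h₁ : voteB I S m w ≠ 1 := fun h' => hw ((voteB_eq_one_iff hS hm₀).1 h')
      have h₂ : (m, w) ∉ S := fun h' => by
        obtain rfl := hS.2.2 h' hm₀
        omega
      rcases voteB_of_notMem (I := I) h₂ with h | h <;> omega
  · rw [h]
    exact (voteB_bounds m w).2

theorem man_of_not_rematched {yA : A → ℤ} {yB : B → ℤ} {r : ℤ} {T : Set (A × B × ℤ)}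
    (hr : r = 0 ∨ r = 1) (hM : IsMatching I M) (hy : IsWitness I M yA yB)
    (hT : IsLabelledStable I (rematchEdges I M yA yB r) T) {m : A} (hm : yA m % 2 ≠ r)
    (hmM : ManMatched M m) (hmT : ∀ w k, (m, w, k) ∉ T) : m ∉ I.C ∧ yA m = -1 := by
  obtain ⟨w, hw⟩ := hmM
  have ht := hy.tight m w hw
  have hyw := hy.woman w
  by_contra hc
  have hX : (m, w, yA m - 1) ∈ rematchEdges I M yA yB r := by
    refine mem_rematchEdges.2 ⟨⟨hM.1 hw, hm, by omega⟩, ⟨by omega, by omega, fun hC => ?_⟩,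
      ⟨le_rfl, fun _ => (voteA_of_mem hw).ge⟩, by omega, fun _ => (voteB_of_mem hw).ge⟩
    have := hy.man m hC
    have : yA m ≠ -1 := fun h => hc ⟨hC, h⟩
    omega
  rcases hT.stable _ hX (hmT _ _) with ⟨⟨m', w', k'⟩, hb, e, -⟩ | ⟨⟨m', w', k'⟩, hb, e, h⟩
  · obtain rfl : m' = m := e
    exact hmT _ _ hb
  · obtain rfl : w' = w := e
    have hmm : m' ≠ m := by
      rintro rfl
      exact hmT _ _ hb
    obtain ⟨⟨hE, hq, -⟩, ⟨hk, -, -⟩, ⟨h₁, h₂⟩, -⟩ := mem_rematchEdges.1 (hT.subset hb)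
    have hedge := hy.edge m' w' hE
    have hn : (m', w') ∉ M := fun h' => hmm (hM.2.2 h' hw)
    have hvA := voteA_of_notMem (I := I) hn
    have hvB := voteB_of_notMem (I := I) hn
    rw [← voteB_eq_one_iff hM hw] at h
    dsimp only at h
    omega

theorem woman_of_not_rematched {yA : A → ℤ} {yB : B → ℤ} {r : ℤ} {T : Set (A × B × ℤ)}
    (hr : r = 0 ∨ r = 1) (hM : IsMatching I M) (hy : IsWitness I M yA yB)
    (hT : IsLabelledStable I (rematchEdges I M yA yB r) T) {w : B} (hw : yB w % 2 ≠ r)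
    (hwM : WomanMatched M w) (hwT : ∀ m k, (m, w, k) ∉ T) : yB w = -1 := by
  obtain ⟨m, hm⟩ := hwM
  have ht := hy.tight m w hm
  have hyw := hy.woman w
  by_contra hc
  have hX : (m, w, yA m + 1) ∈ rematchEdges I M yA yB r := by
    refine mem_rematchEdges.2 ⟨⟨hM.1 hm, by omega, hw⟩, ⟨by omega, by omega, fun hC => ?_⟩,
      ⟨by omega, fun _ => (voteA_of_mem hm).ge⟩, by omega, fun _ => (voteB_of_mem hm).ge⟩
    have := hy.man m hC
    omega
  rcases hT.stable _ hX (hwT _ _) with ⟨⟨m', w', k'⟩, hb, e, h⟩ | ⟨⟨m', w', k'⟩, hb, e, -⟩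
  · obtain rfl : m' = m := e
    have hww : w' ≠ w := by
      rintro rfl
      exact hwT _ _ hb
    obtain ⟨⟨hE, -, hq⟩, ⟨hk, -, -⟩, -, ⟨h₁, h₂⟩⟩ := mem_rematchEdges.1 (hT.subset hb)
    have hedge := hy.edge m' w' hE
    have hn : (m', w') ∉ M := fun h' => hww (hM.2.1 h' hm)
    have hvA := voteA_of_notMem (I := I) hn
    have hvB := voteB_of_notMem (I := I) hn
    rw [← voteA_eq_one_iff hM hm] at h
    dsimp only at h
    omega
  · obtain rfl : w' = w := e
    exact hwT _ _ hb

/-- The matching that keeps the part of `M` with dual values of parity `r` and rematches the other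
vertices according to `T`. -/
noncomputable def rematch (I : CritInstance A B) (M : Finset (A × B)) (yA : A → ℤ) (r : ℤ)
    (T : Set (A × B × ℤ)) : Finset (A × B) :=
  M.filter (fun e => yA e.1 % 2 = r) ∪ I.E.filter fun e => ∃ k, (e.1, e.2, k) ∈ T

/-- The dual values of men after rematching. -/
noncomputable def newDualA (yA : A → ℤ) (r : ℤ) (T : Set (A × B × ℤ)) (m : A) : ℤ :=
  if yA m % 2 = r then yA m else if h : ∃ k w, (m, w, k) ∈ T then h.choose else 0

/-- The dual values of women after rematching. -/
noncomputable def newDualB (yB : B → ℤ) (r : ℤ) (T : Set (A × B × ℤ)) (w : B) : ℤ :=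
  if yB w % 2 = r then yB w else if h : ∃ k m, (m, w, k) ∈ T then - h.choose else 0

section Rematch

variable {yA : A → ℤ} {yB : B → ℤ} {r : ℤ} {T : Set (A × B × ℤ)}

theorem newDualA_of_mem (hT : IsLabelledStable I (rematchEdges I M yA yB r) T) {m : A} {w : B}
    {k : ℤ} (h : (m, w, k) ∈ T) : newDualA yA r T m = k := by
  have hm := (mem_rematchEdges.1 (hT.subset h)).1.2.1
  have hex : ∃ k w, (m, w, k) ∈ T := ⟨k, w, h⟩
  obtain ⟨w', hw'⟩ := hex.choose_spec
  rw [newDualA, if_neg hm, dif_pos hex, (hT.man_unique h hw').2]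

theorem newDualB_of_mem (hT : IsLabelledStable I (rematchEdges I M yA yB r) T) {m : A} {w : B}
    {k : ℤ} (h : (m, w, k) ∈ T) : newDualB yB r T w = -k := by
  have hw := (mem_rematchEdges.1 (hT.subset h)).1.2.2
  have hex : ∃ k m, (m, w, k) ∈ T := ⟨k, m, h⟩
  obtain ⟨m', hm'⟩ := hex.choose_spec
  rw [newDualB, if_neg hw, dif_pos hex, (hT.woman_unique h hm').2]

theorem newDualA_of_not_mem {m : A} (hm : yA m % 2 ≠ r) (h : ∀ w k, (m, w, k) ∉ T) :
    newDualA yA r T m = 0 := by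
  rw [newDualA, if_neg hm, dif_neg fun ⟨k, w, h'⟩ => h w k h']

theorem newDualB_of_not_mem {w : B} (hw : yB w % 2 ≠ r) (h : ∀ m k, (m, w, k) ∉ T) :
    newDualB yB r T w = 0 := by
  rw [newDualB, if_neg hw, dif_neg fun ⟨k, m, h'⟩ => h m k h']

theorem mem_rematch (hT : IsLabelledStable I (rematchEdges I M yA yB r) T) {m : A} {w : B} :
    (m, w) ∈ rematch I M yA r T ↔ ((m, w) ∈ M ∧ yA m % 2 = r) ∨ ∃ k, (m, w, k) ∈ T := by
  simp only [rematch, Finset.mem_union, Finset.mem_filter]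
  refine or_congr_right (and_iff_right_of_imp ?_)
  rintro ⟨k, h⟩
  exact (mem_rematchEdges.1 (hT.subset h)).1.1

theorem mem_rematch_of_man (hT : IsLabelledStable I (rematchEdges I M yA yB r) T) {m : A}
    (hm : yA m % 2 = r) {w : B} : (m, w) ∈ rematch I M yA r T ↔ (m, w) ∈ M := by
  rw [mem_rematch hT]
  refine ⟨?_, fun h => Or.inl ⟨h, hm⟩⟩
  rintro (h | ⟨k, h⟩)
  · exact h.1
  · exact absurd hm (mem_rematchEdges.1 (hT.subset h)).1.2.1

theorem mem_rematch_of_woman (hr : r = 0 ∨ r = 1) (hy : IsWitness I M yA yB)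
    (hT : IsLabelledStable I (rematchEdges I M yA yB r) T) {w : B}
    (hw : yB w % 2 = r) {m : A} : (m, w) ∈ rematch I M yA r T ↔ (m, w) ∈ M := by
  rw [mem_rematch hT]
  refine ⟨?_, fun h => Or.inl ⟨h, ?_⟩⟩
  · rintro (h | ⟨k, h⟩)
    · exact h.1
    · exact absurd hw (mem_rematchEdges.1 (hT.subset h)).1.2.2
  · have := hy.tight m w h
    omega

theorem mem_rematch_of_man_ne (hT : IsLabelledStable I (rematchEdges I M yA yB r) T) {m : A}
    (hm : yA m % 2 ≠ r) {w : B} :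
    (m, w) ∈ rematch I M yA r T ↔ ∃ k, (m, w, k) ∈ T := by
  rw [mem_rematch hT]
  exact or_iff_right fun h => hm h.2

theorem mem_rematch_of_woman_ne (hr : r = 0 ∨ r = 1) (hy : IsWitness I M yA yB)
    (hT : IsLabelledStable I (rematchEdges I M yA yB r) T) {w : B}
    (hw : yB w % 2 ≠ r) {m : A} : (m, w) ∈ rematch I M yA r T ↔ ∃ k, (m, w, k) ∈ T := by
  rw [mem_rematch hT]
  refine or_iff_right fun h => ?_
  have := hy.tight m w h.1
  omega

theorem rematch_isMatching (hr : r = 0 ∨ r = 1) (hM : IsMatching I M) (hy : IsWitness I M yA yB)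
    (hT : IsLabelledStable I (rematchEdges I M yA yB r) T) :
    IsMatching I (rematch I M yA r T) := by
  refine ⟨?_, ?_, ?_⟩
  · exact Finset.union_subset ((Finset.filter_subset _ _).trans hM.1) (Finset.filter_subset _ _)
  · intro m w w' h h'
    by_cases hm : yA m % 2 = r
    · rw [mem_rematch_of_man hT hm] at h h'
      exact hM.2.1 h h'
    · rw [mem_rematch_of_man_ne hT hm] at h h'
      obtain ⟨k, h⟩ := h
      obtain ⟨k', h'⟩ := h'
      exact (hT.man_unique h h').1
  · intro m m' w h h'
    by_cases hw : yB w % 2 = r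
    · rw [mem_rematch_of_woman hr hy hT hw] at h h'
      exact hM.2.2 h h'
    · rw [mem_rematch_of_woman_ne hr hy hT hw] at h h'
      obtain ⟨k, h⟩ := h
      obtain ⟨k', h'⟩ := h'
      exact (hT.woman_unique h h').1

theorem rematch_isFeasible (hr : r = 0 ∨ r = 1) (hM : IsFeasible I M) (hy : IsWitness I M yA yB)
    (hT : IsLabelledStable I (rematchEdges I M yA yB r) T) :
    IsFeasible I (rematch I M yA r T) := by
  refine ⟨rematch_isMatching hr hM.1 hy hT, fun m hC => ?_⟩
  by_cases hm : yA m % 2 = r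
  · obtain ⟨w, hw⟩ := hM.2 m hC
    exact ⟨w, (mem_rematch_of_man hT hm).2 hw⟩
  · by_contra hn
    refine (man_of_not_rematched hr hM.1 hy hT hm (hM.2 m hC) fun w k h => hn ⟨w, ?_⟩).1 hC
    exact (mem_rematch_of_man_ne hT hm).2 ⟨k, h⟩

theorem voteA_rematch (hT : IsLabelledStable I (rematchEdges I M yA yB r) T) {m : A}
    (hm : yA m % 2 = r) (w : B) : voteA I (rematch I M yA r T) m w = voteA I M m w := by
  simp only [voteA, mem_rematch_of_man hT hm]

theorem voteB_rematch (hr : r = 0 ∨ r = 1) (hy : IsWitness I M yA yB)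
    (hT : IsLabelledStable I (rematchEdges I M yA yB r) T) {w : B}
    (hw : yB w % 2 = r) (m : A) : voteB I (rematch I M yA r T) m w = voteB I M m w := by
  simp only [voteB, mem_rematch_of_woman hr hy hT hw]

theorem voteA_sub_newDualA_le (hr : r = 0 ∨ r = 1) (hM : IsMatching I M)
    (hy : IsWitness I M yA yB) (hT : IsLabelledStable I (rematchEdges I M yA yB r) T) {m : A}
    {w : B} (hm : yA m % 2 ≠ r) (hn : (m, w) ∉ M) :
    voteA I (rematch I M yA r T) m w - newDualA yA r T m ≤ voteA I M m w - yA m + 1 := by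
  have hS := rematch_isMatching hr hM hy hT
  have hb := voteA_bounds (I := I) (M := rematch I M yA r T) m w
  have hb' := voteA_bounds (I := I) (M := M) m w
  by_cases h : ∃ w' k, (m, w', k) ∈ T
  · obtain ⟨w', k, h⟩ := h
    rw [newDualA_of_mem hT h]
    obtain ⟨-, ⟨hk, -⟩, ⟨h₁, h₂⟩, -⟩ := mem_rematchEdges.1 (hT.subset h)
    by_cases hkm : k = yA m - 1
    · have := voteA_le_voteA hM hS hn ((mem_rematch hT).2 (Or.inr ⟨k, h⟩)) (h₂ hkm)
      omega
    · omega
  · push Not at h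
    rw [newDualA_of_not_mem hm h]
    by_cases hmM : ManMatched M m
    · have := (man_of_not_rematched hr hM hy hT hm hmM h).2
      omega
    · rw [voteA_of_not_matched hmM, hy.man_unmatched m hmM]
      omega

theorem voteB_sub_newDualB_le (hr : r = 0 ∨ r = 1) (hM : IsMatching I M)
    (hy : IsWitness I M yA yB) (hT : IsLabelledStable I (rematchEdges I M yA yB r) T) {m : A}
    {w : B} (hw : yB w % 2 ≠ r) (hn : (m, w) ∉ M) :
    voteB I (rematch I M yA r T) m w - newDualB yB r T w ≤ voteB I M m w - yB w + 1 := by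
  have hS := rematch_isMatching hr hM hy hT
  have hb := voteB_bounds (I := I) (M := rematch I M yA r T) m w
  have hb' := voteB_bounds (I := I) (M := M) m w
  by_cases h : ∃ m' k, (m', w, k) ∈ T
  · obtain ⟨m', k, h⟩ := h
    rw [newDualB_of_mem hT h]
    obtain ⟨-, ⟨hk, -⟩, -, ⟨h₁, h₂⟩⟩ := mem_rematchEdges.1 (hT.subset h)
    by_cases hkw : k = 1 - yB w
    · have := voteB_le_voteB hM hS hn ((mem_rematch hT).2 (Or.inr ⟨k, h⟩)) (h₂ hkw)
      omega
    · omega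
  · push Not at h
    rw [newDualB_of_not_mem hw h]
    by_cases hwM : WomanMatched M w
    · have := woman_of_not_rematched hr hM hy hT hw hwM h
      omega
    · rw [voteB_of_not_matched hwM, hy.woman_unmatched w hwM]
      omega

/-- Man `m` accepts the edge to `w` with every label of parity `r` that is at least some bound, and
prefers it to his edge of `T`. -/
theorem exists_man_threshold (hr : r = 0 ∨ r = 1) (hM : IsFeasible I M)
    (hy : IsWitness I M yA yB) (hT : IsLabelledStable I (rematchEdges I M yA yB r) T) {m : A}
    {w : B} (hm : yA m % 2 ≠ r) (hn : (m, w) ∉ rematch I M yA r T) :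
    ∃ K, K % 2 = r ∧ K ≤ newDualA yA r T m + 1 - voteA I (rematch I M yA r T) m w ∧ ∀ k, K ≤ k →
      k % 2 = r → (m ∉ I.C → -1 ≤ k) ∧
        (yA m - 1 ≤ k ∧ (k = yA m - 1 → 0 ≤ voteA I M m w)) ∧
        ∀ b ∈ T, ¬ ManBetter I b (m, w, k) := by
  have hS := rematch_isMatching hr hM.1 hy hT
  by_cases h : ∃ w' k, (m, w', k) ∈ T
  · obtain ⟨w₁, k₁, h⟩ := h
    have h₀ := (mem_rematch hT).2 (Or.inr ⟨k₁, h⟩)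
    have hv := voteA_eq_one_iff hS h₀ (w := w)
    have hb := voteA_of_notMem (I := I) hn
    obtain ⟨-, ⟨hk, -, hC⟩, ⟨h₁, h₂⟩, -⟩ := mem_rematchEdges.1 (hT.subset h)
    refine ⟨k₁ + 1 - voteA I (rematch I M yA r T) m w, by omega,
      by rw [newDualA_of_mem hT h], fun k hKk hkr => ?_⟩
    have hlt : k₁ < k ∨ k₁ = k ∧ I.prefA m w w₁ := by
      rcases hb with hb | hb
      · exact Or.inl (by omega)
      · rcases lt_or_eq_of_le (show k₁ ≤ k by omega) with h' | h'
        · exact Or.inl h'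
        · exact Or.inr ⟨h', hv.1 hb⟩
    refine ⟨fun hm => ?_, ⟨by omega, fun hkm => ?_⟩, ?_⟩
    · have := hC hm
      omega
    · obtain ⟨rfl, hp⟩ := hlt.resolve_left (by omega)
      exact voteA_nonneg_of_pref hM.1 (h₂ hkm) hp
    · rintro ⟨m', w', k'⟩ hbT ⟨e, hb'⟩
      obtain rfl : m' = m := e
      obtain ⟨rfl, rfl⟩ := hT.man_unique h hbT
      dsimp only at hb'
      rcases hlt with hlt | ⟨rfl, hp⟩
      · omega
      · rcases hb' with hb' | hb'
        · omega
        · exact I.prefA_irrefl _ _ (I.prefA_trans _ _ _ _ hp hb'.2)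
  · push Not at h
    have hbound := voteA_bounds (I := I) (M := rematch I M yA r T) m w
    refine ⟨-r, by omega, by rw [newDualA_of_not_mem hm h]; omega, fun k hKk hkr =>
      ⟨fun _ => by omega, ?_, ?_⟩⟩
    · by_cases hmM : ManMatched M m
      · have := (man_of_not_rematched hr hM.1 hy hT hm hmM h).2
        omega
      · have := voteA_of_not_matched (I := I) hmM w
        have := hy.man_unmatched m hmM
        omega
    · rintro ⟨m', w', k'⟩ hbT ⟨e, -⟩
      obtain rfl : m' = m := e
      exact h _ _ hbT

/-- Woman `w` accepts the edge to `m` with every label of parity `r` that is at most some bound, and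
prefers it to her edge of `T`. -/
theorem exists_woman_threshold (hr : r = 0 ∨ r = 1) (hM : IsMatching I M)
    (hy : IsWitness I M yA yB) (hT : IsLabelledStable I (rematchEdges I M yA yB r) T) {m : A}
    {w : B} (hw : yB w % 2 ≠ r) (hn : (m, w) ∉ rematch I M yA r T) :
    ∃ K, K % 2 = r ∧ voteB I (rematch I M yA r T) m w - 1 - newDualB yB r T w ≤ K ∧ ∀ k, k ≤ K →
      k % 2 = r → k ≤ 1 ∧ (k ≤ 1 - yB w ∧ (k = 1 - yB w → 0 ≤ voteB I M m w)) ∧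
        ∀ b ∈ T, ¬ WomanBetter I b (m, w, k) := by
  have hS := rematch_isMatching hr hM hy hT
  by_cases h : ∃ m' k, (m', w, k) ∈ T
  · obtain ⟨m₁, k₁, h⟩ := h
    have h₀ := (mem_rematch hT).2 (Or.inr ⟨k₁, h⟩)
    have hv := voteB_eq_one_iff hS h₀ (m := m)
    have hb := voteB_of_notMem (I := I) hn
    obtain ⟨-, ⟨hk, hk1, -⟩, -, ⟨h₁, h₂⟩⟩ := mem_rematchEdges.1 (hT.subset h)
    refine ⟨k₁ - 1 + voteB I (rematch I M yA r T) m w, by omega,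
      by rw [newDualB_of_mem hT h]; omega, fun k hKk hkr => ?_⟩
    have hlt : k < k₁ ∨ k = k₁ ∧ I.prefB w m m₁ := by
      rcases hb with hb | hb
      · exact Or.inl (by omega)
      · rcases lt_or_eq_of_le (show k ≤ k₁ by omega) with h' | h'
        · exact Or.inl h'
        · exact Or.inr ⟨h', hv.1 hb⟩
    refine ⟨by omega, ⟨by omega, fun hkm => ?_⟩, ?_⟩
    · obtain ⟨rfl, hp⟩ := hlt.resolve_left (by omega)
      exact voteB_nonneg_of_pref hM (h₂ hkm) hp
    · rintro ⟨m', w', k'⟩ hbT ⟨e, hb'⟩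
      obtain rfl : w' = w := e
      obtain ⟨rfl, rfl⟩ := hT.woman_unique h hbT
      dsimp only at hb'
      rcases hlt with hlt | ⟨rfl, hp⟩
      · omega
      · rcases hb' with hb' | hb'
        · omega
        · exact I.prefB_irrefl _ _ (I.prefB_trans _ _ _ _ hp hb'.2)
  · push Not at h
    have hbound := voteB_bounds (I := I) (M := rematch I M yA r T) m w
    refine ⟨r, by omega, by rw [newDualB_of_not_mem hw h]; omega, fun k hKk hkr =>
      ⟨by omega, ?_, ?_⟩⟩
    · by_cases hwM : WomanMatched M w
      · have := woman_of_not_rematched hr hM hy hT hw hwM h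
        omega
      · have := voteB_of_not_matched (I := I) hwM m
        have := hy.woman_unmatched w hwM
        omega
    · rintro ⟨m', w', k'⟩ hbT ⟨e, -⟩
      obtain rfl : w' = w := e
      exact h _ _ hbT

theorem rematch_edge (hr : r = 0 ∨ r = 1) (hM : IsFeasible I M) (hy : IsWitness I M yA yB)
    (hT : IsLabelledStable I (rematchEdges I M yA yB r) T) {m : A} {w : B}
    (hE : (m, w) ∈ I.E) :
    voteA I (rematch I M yA r T) m w + voteB I (rematch I M yA r T) m w ≤
      newDualA yA r T m + newDualB yB r T w := by
  have hedge := hy.edge m w hE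
  have heven := vote_add_even (I := I) (M := M) m w
  by_cases hm : yA m % 2 = r <;> by_cases hw : yB w % 2 = r
  · rw [voteA_rematch hT hm, voteB_rematch hr hy hT hw, newDualA, newDualB, if_pos hm, if_pos hw]
    exact hedge
  · have hn : (m, w) ∉ M := fun h => by
      have := hy.tight m w h
      omega
    have := voteB_sub_newDualB_le hr hM.1 hy hT hw hn
    rw [voteA_rematch hT hm, newDualA, if_pos hm]
    omega
  · have hn : (m, w) ∉ M := fun h => by
      have := hy.tight m w h
      omega
    have := voteA_sub_newDualA_le hr hM.1 hy hT hm hn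
    rw [voteB_rematch hr hy hT hw, newDualB, if_pos hw]
    omega
  · by_cases hS : (m, w) ∈ rematch I M yA r T
    · obtain ⟨k, hk⟩ := (mem_rematch_of_man_ne hT hm).1 hS
      rw [voteA_of_mem hS, voteB_of_mem hS, newDualA_of_mem hT hk, newDualB_of_mem hT hk]
      omega
    · obtain ⟨K₁, hK₁, hle₁, h₁⟩ := exists_man_threshold hr hM hy hT hm hS
      obtain ⟨K₂, hK₂, hle₂, h₂⟩ := exists_woman_threshold hr hM.1 hy hT hw hS
      by_cases hK : K₁ ≤ K₂
      · obtain ⟨hC, hA, hbA⟩ := h₁ K₁ le_rfl hK₁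
        obtain ⟨h1, hB, hbB⟩ := h₂ K₁ hK hK₁
        exfalso
        rcases hT.stable (m, w, K₁) (mem_rematchEdges.2 ⟨⟨hE, hm, hw⟩, ⟨hK₁, h1, hC⟩, hA, hB⟩)
          (fun h => hS ((mem_rematch hT).2 (Or.inr ⟨_, h⟩))) with ⟨b, hb, h⟩ | ⟨b, hb, h⟩
        · exact hbA b hb h
        · exact hbB b hb h
      · omega

theorem rematch_isWitness (hr : r = 0 ∨ r = 1) (hM : IsFeasible I M) (hy : IsWitness I M yA yB)
    (hT : IsLabelledStable I (rematchEdges I M yA yB r) T) :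
    IsWitness I (rematch I M yA r T) (newDualA yA r T) (newDualB yB r T) where
  edge _ _ h := rematch_edge hr hM hy hT h
  tight m w h := by
    rcases (mem_rematch hT).1 h with ⟨hMw, hm⟩ | ⟨k, hk⟩
    · have ht := hy.tight m w hMw
      rw [newDualA, newDualB, if_pos hm, if_pos (by omega), ht]
    · rw [newDualA_of_mem hT hk, newDualB_of_mem hT hk, add_neg_cancel]
  man_unmatched m h := by
    by_cases hm : yA m % 2 = r
    · rw [newDualA, if_pos hm]
      exact hy.man_unmatched m fun ⟨w, hw⟩ => h ⟨w, (mem_rematch_of_man hT hm).2 hw⟩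
    · exact newDualA_of_not_mem hm fun w k hk => h ⟨w, (mem_rematch hT).2 (Or.inr ⟨k, hk⟩)⟩
  woman_unmatched w h := by
    by_cases hw : yB w % 2 = r
    · rw [newDualB, if_pos hw]
      exact hy.woman_unmatched w fun ⟨m, hm⟩ => h ⟨m, (mem_rematch_of_woman hr hy hT hw).2 hm⟩
    · exact newDualB_of_not_mem hw fun m k hk => h ⟨m, (mem_rematch hT).2 (Or.inr ⟨k, hk⟩)⟩
  man m hC := by
    by_cases hm : yA m % 2 = r
    · rw [newDualA, if_pos hm]
      exact hy.man m hC
    · by_cases h : ∃ w k, (m, w, k) ∈ T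
      · obtain ⟨w, k, h⟩ := h
        rw [newDualA_of_mem hT h]
        exact (mem_rematchEdges.1 (hT.subset h)).2.1.2.2 hC
      · push Not at h
        rw [newDualA_of_not_mem hm h]
        norm_num
  woman w := by
    by_cases hw : yB w % 2 = r
    · rw [newDualB, if_pos hw]
      exact hy.woman w
    · by_cases h : ∃ m k, (m, w, k) ∈ T
      · obtain ⟨m, k, h⟩ := h
        rw [newDualB_of_mem hT h]
        have := (mem_rematchEdges.1 (hT.subset h)).2.1.2.1
        omega
      · push Not at h
        rw [newDualB_of_not_mem hw h]
        norm_num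

theorem newDualA_parity (hT : IsLabelledStable I (rematchEdges I M yA yB r) T) {m : A} {w : B}
    (h : (m, w) ∈ rematch I M yA r T) : newDualA yA r T m % 2 = r := by
  rcases (mem_rematch hT).1 h with ⟨-, hm⟩ | ⟨k, hk⟩
  · rw [newDualA, if_pos hm, hm]
  · rw [newDualA_of_mem hT hk]
    exact (mem_rematchEdges.1 (hT.subset hk)).2.1.1

end Rematch

/-- The part of a popular feasible matching with dual values of parity `r` extends to a feasible
matching with a witness all of whose matched vertices have dual values of parity `r`. -/
theorem IsWitness.exists_parity {yA : A → ℤ} {yB : B → ℤ} {r : ℤ} (hr : r = 0 ∨ r = 1)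
    (hM : IsFeasible I M) (hy : IsWitness I M yA yB) :
    ∃ S zA zB, IsFeasible I S ∧ IsWitness I S zA zB ∧
      (∀ m w, (m, w) ∈ M → yA m % 2 = r → (m, w) ∈ S) ∧
      ∀ m w, (m, w) ∈ S → zA m % 2 = r := by
  obtain ⟨T, hT⟩ := exists_isLabelledStable (I := I) (rematchEdges I M yA yB r)
    (finite_rematchEdges yA yB r) fun m w k h => (mem_rematchEdges.1 h).1.1
  exact ⟨_, _, _, rematch_isFeasible hr hM hy hT, rematch_isWitness hr hM hy hT,
    fun m w h hm => (mem_rematch hT).2 (Or.inl ⟨h, hm⟩), fun m w h => newDualA_parity hT h⟩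

end CritInstance

/-- In a marriage instance with critical men that admits a feasible
matching, an edge `e ∈ E` belongs to some popular feasible matching if and only if it
belongs to some minimum size popular feasible matching or to some dominant feasible
matching. -/
theorem popular_feasible_edge_iff {A : Type u} {B : Type v} [Fintype A] [Fintype B]
    (I : CritInstance A B) (e : A × B) (he : e ∈ I.E)
    (hfeas : ∃ F, I.IsFeasible F) :
    (∃ M, I.IsPFM M ∧ e ∈ M) ↔
      ((∃ M, I.IsMinPFM M ∧ e ∈ M) ∨ (∃ M, I.IsDFM M ∧ e ∈ M)) := by
  constructor
  · rintro ⟨M, hM, heM⟩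
    obtain ⟨yA, yB, hy⟩ := hM.exists_isWitness
    rcases Int.emod_two_eq_zero_or_one (yA e.1) with h | h
    · obtain ⟨S, zA, zB, hS, hz, hsub, hpar⟩ := hy.exists_parity (Or.inl rfl) hM.1
      exact Or.inl ⟨S, hz.isMinPFM hS hpar, hsub e.1 e.2 heM h⟩
    · obtain ⟨S, zA, zB, hS, hz, hsub, hpar⟩ := hy.exists_parity (Or.inr rfl) hM.1
      exact Or.inr ⟨S, hz.isDFM hS hpar, hsub e.1 e.2 heM h⟩
  · rintro (⟨M, hM, heM⟩ | ⟨M, hM, heM⟩)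
    · exact ⟨M, hM.1, heM⟩
    · exact ⟨M, hM.1, heM⟩
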